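/- arXiv:2605.30586 — 2 statements merged into one kernel-verified Lean document; each statement's English description precedes it below -/
import Mathlib

section
/- Let d be a positive integer and s ∈ (0,1) with d ≥ 4 − 2s. Then for every real-valued u ∈ C_c^∞(Ω^{(3)}) one has T_s[u] ≥ C_{fH}(d,s) · ∫_{ℝ^{3d}} V_{s,3}(x₁,x₂,x₃) · u(x₁,x₂,x₃)² dx₁dx₂dx₃. -/
open MeasureTheory Real

noncomputable section

/-- `ℝ^d` as a Euclidean space. -/
abbrev Euc (d : ℕ) := EuclideanSpace ℝ (Fin d)

/-- The normalisation constant `a_{s,d}` of the fractional Laplacian. -/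
def a_sd (d : ℕ) (s : ℝ) : ℝ :=
  s * (2:ℝ) ^ (2*s - 1) * Real.pi ^ (-(d:ℝ)/2) * Real.Gamma (((d:ℝ) + 2*s)/2) /
    Real.Gamma (1 - s)

/-- The sharp fractional Hardy constant `C_{fH}(d,s)`. -/
def C_fH (d : ℕ) (s : ℝ) : ℝ :=
  (2:ℝ) ^ (2*s) * (Real.Gamma (((d:ℝ) + 2*s)/4))^2 / (Real.Gamma (((d:ℝ) - 2*s)/4))^2

/-- The three-particle Hardy potential `V_{s,3}` (cyclic sum). -/
def V3 {d : ℕ} (s : ℝ) (x₁ x₂ x₃ : Euc d) : ℝ :=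
    ‖x₃ - x₂‖ ^ (2*s) / (‖x₃ - x₁‖ ^ (2*s) * ‖x₂ - x₁‖ ^ (2*s))
  + ‖x₁ - x₃‖ ^ (2*s) / (‖x₁ - x₂‖ ^ (2*s) * ‖x₃ - x₂‖ ^ (2*s))
  + ‖x₂ - x₁‖ ^ (2*s) / (‖x₂ - x₃‖ ^ (2*s) * ‖x₁ - x₃‖ ^ (2*s))

/-- The fractional kinetic energy `T_s[u]` of an `N`-particle wave function. -/
def kinetic (d N : ℕ) (s : ℝ) (u : (Fin N → Euc d) → ℝ) : ℝ :=
  ∑ i : Fin N, a_sd d s *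
    ∫ x : Fin N → Euc d, ∫ z : Euc d,
      (u x - u (Function.update x i z))^2 / ‖x i - z‖ ^ ((d:ℝ) + 2*s)

/-- Euler's beta integral on the open unit interval. -/
lemma integral_beta_Ioo {a b : ℝ} (ha : 0 < a) (hb : 0 < b) :
    IntegrableOn (fun x : ℝ ↦ x ^ (a - 1) * (1 - x) ^ (b - 1)) (Set.Ioo 0 1) ∧
    ∫ x in Set.Ioo (0:ℝ) 1, x ^ (a - 1) * (1 - x) ^ (b - 1) =
      Gamma a * Gamma b / Gamma (a + b) := by
  have hB : 0 < ProbabilityTheory.beta a b := ProbabilityTheory.beta_pos ha hb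
  have h1 := ProbabilityTheory.lintegral_betaPDF_eq_one ha hb
  rw [ProbabilityTheory.lintegral_betaPDF] at h1
  have hm : AEStronglyMeasurable
      (fun x : ℝ ↦ 1 / ProbabilityTheory.beta a b * x ^ (a - 1) * (1 - x) ^ (b - 1))
      (volume.restrict (Set.Ioo 0 1)) := by
    apply Measurable.aestronglyMeasurable; fun_prop
  have hnn : 0 ≤ᵐ[volume.restrict (Set.Ioo (0:ℝ) 1)]
      fun x : ℝ ↦ 1 / ProbabilityTheory.beta a b * x ^ (a - 1) * (1 - x) ^ (b - 1) := by
    filter_upwards [ae_restrict_mem measurableSet_Ioo] with x hx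
    have := hx.1
    have : 0 ≤ 1 - x := by linarith [hx.2]
    show (0:ℝ) ≤ _
    positivity
  have hi : IntegrableOn
      (fun x : ℝ ↦ 1 / ProbabilityTheory.beta a b * x ^ (a - 1) * (1 - x) ^ (b - 1))
      (Set.Ioo 0 1) := by
    refine ⟨hm, ?_⟩
    rw [hasFiniteIntegral_iff_ofReal hnn, h1]
    exact ENNReal.one_lt_top
  have hv : ∫ x in Set.Ioo (0:ℝ) 1,
      1 / ProbabilityTheory.beta a b * x ^ (a - 1) * (1 - x) ^ (b - 1) = 1 := by
    rw [integral_eq_lintegral_of_nonneg_ae hnn hm, h1, ENNReal.toReal_one]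
  constructor
  · refine Integrable.congr (hi.const_mul (ProbabilityTheory.beta a b))
      (ae_of_all _ fun x ↦ ?_)
    field_simp
  · simp_rw [mul_assoc, integral_const_mul] at hv
    field_simp at hv
    rw [hv, ProbabilityTheory.beta]

/-- The profile `σ^{-1-s} (1 - (1-σ)_+^{β-1})`. -/
def hardyProfile (s β σ : ℝ) : ℝ :=
  σ ^ (-1 - s) * (1 - if σ < 1 then (1 - σ) ^ (β - 1) else 0)

lemma one_sub_one_sub_rpow_le {β σ : ℝ} (hβ : 0 < β) (h0 : 0 ≤ σ) (h1 : σ ≤ 1) :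
    1 - (1 - σ) ^ β ≤ max 1 β * σ := by
  rcases le_total 1 β with h | h
  · rw [max_eq_right h]
    have := one_add_mul_self_le_rpow_one_add (s := -σ) (by linarith) h
    rw [← sub_eq_add_neg] at this
    linarith
  · rw [max_eq_left h]
    have := rpow_le_rpow_of_exponent_ge' (x := 1 - σ) (by linarith) (by linarith) hβ.le h
    rw [rpow_one] at this
    linarith

lemma integral_hardyProfile_Ioo {s β : ℝ} (hs0 : 0 < s) (hs1 : s < 1) (hβ : s ≤ β) :
    IntegrableOn (hardyProfile s β) (Set.Ioo 0 1) ∧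
    ∫ σ in Set.Ioo (0:ℝ) 1, hardyProfile s β σ =
      -1 / s + Gamma (1 - s) * Gamma β / (s * Gamma (β - s)) := by
  have hβ0 : 0 < β := hs0.trans_le hβ
  obtain ⟨hbi, hbv⟩ := integral_beta_Ioo (a := 1 - s) (b := β) (by linarith) hβ0
  have hexp : 1 - s - 1 = -s := by ring
  rw [hexp] at hbi hbv
  set G : ℝ → ℝ := fun σ ↦ σ ^ (-1 - s) * (1 - (1 - σ) ^ β) with hG
  set B : ℝ → ℝ := fun σ ↦ σ ^ (-s) * (1 - σ) ^ (β - 1) with hBdef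
  have hpow : ∀ σ ∈ Set.Ioo (0:ℝ) 1, σ ^ (-1 - s) * σ = σ ^ (-s) := fun σ hσ ↦ by
    rw [← rpow_add_one hσ.1.ne']; congr 1; ring
  have hGi : IntegrableOn G (Set.Ioo 0 1) := by
    have hint : IntegrableOn (fun σ : ℝ ↦ max 1 β * σ ^ (-s)) (Set.Ioo 0 1) := by
      have := intervalIntegral.intervalIntegrable_rpow' (a := 0) (b := 1) (r := -s) (by linarith)
      rw [intervalIntegrable_iff_integrableOn_Ioo_of_le zero_le_one] at this
      exact this.const_mul _
    refine hint.mono' (by apply Measurable.aestronglyMeasurable; fun_prop) ?_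
    filter_upwards [ae_restrict_mem measurableSet_Ioo] with σ hσ
    have h1 : (1 - σ) ^ β ≤ 1 := rpow_le_one (by linarith [hσ.2]) (by linarith [hσ.1]) hβ0.le
    have h2 : 0 < σ ^ (-1 - s) := rpow_pos_of_pos hσ.1 _
    rw [Real.norm_of_nonneg (mul_nonneg h2.le (by linarith)), ← hpow σ hσ]
    calc _ ≤ σ ^ (-1 - s) * (max 1 β * σ) := by
          gcongr; exact one_sub_one_sub_rpow_le hβ0 hσ.1.le hσ.2.le
      _ = _ := by ring
  have heq : ∀ σ ∈ Set.Ioo (0:ℝ) 1, hardyProfile s β σ = G σ - B σ := fun σ hσ ↦ by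
    have h1 : (1 - σ) ^ β = (1 - σ) ^ (β - 1) * (1 - σ) := by
      rw [← rpow_add_one (by linarith [hσ.2])]; congr 1; ring
    simp only [hardyProfile, hG, hBdef, if_pos hσ.2, h1, ← hpow σ hσ]
    ring
  have hGv : ∫ σ in Set.Ioo (0:ℝ) 1, (G σ - β / s * B σ) = -1 / s := by
    have hFTC := intervalIntegral.integral_eq_sub_of_hasDerivAt_of_tendsto
      (f := fun σ : ℝ ↦ -1 / s * (σ ^ (-s) * (1 - (1 - σ) ^ β)))
      (f' := fun σ ↦ G σ - β / s * B σ) (a := 0) (b := 1) (fa := 0) (fb := -1 / s)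
      zero_lt_one ?_ ?_ ?_ ?_
    · rw [intervalIntegral.integral_of_le zero_le_one, integral_Ioc_eq_integral_Ioo] at hFTC
      rw [hFTC, sub_zero]
    · intro σ hσ
      have hd1 : HasDerivAt (fun σ : ℝ ↦ σ ^ (-s)) (-s * σ ^ (-s - 1)) σ :=
        hasDerivAt_rpow_const (Or.inl hσ.1.ne')
      have hd2 : HasDerivAt (fun σ : ℝ ↦ (1 - σ) ^ β) (-1 * β * (1 - σ) ^ (β - 1)) σ :=
        ((hasDerivAt_id σ).const_sub 1).rpow_const (Or.inl (by simp; linarith [hσ.2]))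
      refine ((hd1.mul (hd2.const_sub 1)).const_mul (-1 / s)).congr_deriv ?_
      simp only [hG, hBdef, show -s - 1 = -1 - s by ring]
      field_simp
      ring
    · rw [intervalIntegrable_iff_integrableOn_Ioo_of_le zero_le_one]
      exact hGi.sub (hbi.const_mul _)
    · have hz : Filter.Tendsto (fun σ : ℝ ↦ 1 / s * (max 1 β * σ ^ (1 - s)))
          (nhdsWithin 0 (Set.Ioi 0)) (nhds 0) := by
        have : ContinuousAt (fun σ : ℝ ↦ 1 / s * (max 1 β * σ ^ (1 - s))) 0 := by
          have := continuousAt_rpow_const 0 (1 - s) (Or.inr (by linarith))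
          fun_prop
        have h2 := this.tendsto
        rw [zero_rpow (by linarith), mul_zero, mul_zero] at h2
        exact h2.mono_left nhdsWithin_le_nhds
      refine squeeze_zero_norm' ?_ hz
      filter_upwards [Ioo_mem_nhdsGT (zero_lt_one (α := ℝ))] with σ hσ
      have h1 : (1 - σ) ^ β ≤ 1 := rpow_le_one (by linarith [hσ.2]) (by linarith [hσ.1]) hβ0.le
      have h2 : 0 < σ ^ (-s) := rpow_pos_of_pos hσ.1 _
      have h3 : σ ^ (1 - s) = σ ^ (-s) * σ := by
        rw [← rpow_add_one hσ.1.ne']; congr 1; ring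
      rw [norm_mul, Real.norm_of_nonneg (mul_nonneg h2.le (by linarith)), Real.norm_eq_abs,
        abs_div, abs_neg, abs_one, abs_of_pos hs0, h3]
      have := one_sub_one_sub_rpow_le hβ0 hσ.1.le hσ.2.le
      calc _ ≤ 1 / s * (σ ^ (-s) * (max 1 β * σ)) := by gcongr
        _ = _ := by ring
    · have : ContinuousAt (fun σ : ℝ ↦ -1 / s * (σ ^ (-s) * (1 - (1 - σ) ^ β))) 1 := by
        have h1 := continuousAt_rpow_const 1 (-s) (Or.inl one_ne_zero)
        have h2 : ContinuousAt (fun σ : ℝ ↦ (1 - σ) ^ β) 1 :=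
          (continuousAt_const.sub continuousAt_id).rpow_const (Or.inr hβ0.le)
        fun_prop
      have h2 := this.tendsto
      rw [sub_self, zero_rpow hβ0.ne', one_rpow, sub_zero, one_mul, mul_one] at h2
      exact h2.mono_left nhdsWithin_le_nhds
  refine ⟨(hGi.sub hbi).congr_fun (fun σ hσ ↦ (heq σ hσ).symm) measurableSet_Ioo, ?_⟩
  rw [setIntegral_congr_fun measurableSet_Ioo heq]
  have hsplit : ∀ σ, G σ - B σ = (G σ - β / s * B σ) + (β / s - 1) * B σ := fun σ ↦ by ring
  simp_rw [hsplit]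
  rw [integral_add (f := fun σ ↦ G σ - β / s * B σ) (hGi.sub (hbi.const_mul _))
    (hbi.const_mul _), hGv, integral_const_mul, hbv]
  congr 1
  rcases hβ.eq_or_lt with h | h
  · subst h; simp [hs0.ne']
  · have h1 : Gamma (1 - s + β) = (β - s) * Gamma (β - s) := by
      rw [← Gamma_add_one (by linarith)]; congr 1; ring
    have h2 : β - s ≠ 0 := by linarith
    rw [h1]
    have h3 : Gamma (β - s) ≠ 0 := (Gamma_pos_of_pos (by linarith)).ne'
    field_simp

/-- The fractional integral of the profile: the value `Γ(1-s) Γ(β) / (s Γ(β-s))`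
(which is `0` when `β = s`). -/
lemma integral_hardyProfile {s β : ℝ} (hs0 : 0 < s) (hs1 : s < 1) (hβ : s ≤ β) :
    IntegrableOn (hardyProfile s β) (Set.Ioi 0) ∧
    ∫ σ in Set.Ioi (0:ℝ), hardyProfile s β σ =
      Gamma (1 - s) * Gamma β / (s * Gamma (β - s)) := by
  obtain ⟨hi, hv⟩ := integral_hardyProfile_Ioo hs0 hs1 hβ
  have hE : Set.EqOn (hardyProfile s β) (fun σ ↦ σ ^ (-1 - s)) (Set.Ici 1) := fun σ hσ ↦ by
    simp [hardyProfile, not_lt.mpr (show (1:ℝ) ≤ σ from hσ)]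
  have hi2 : IntegrableOn (hardyProfile s β) (Set.Ici 1) := by
    refine IntegrableOn.congr_fun ?_ hE.symm measurableSet_Ici
    rw [integrableOn_Ici_iff_integrableOn_Ioi]
    exact integrableOn_Ioi_rpow_of_lt (by linarith) zero_lt_one
  have hv2 : ∫ σ in Set.Ici (1:ℝ), hardyProfile s β σ = 1 / s := by
    rw [setIntegral_congr_fun measurableSet_Ici hE, integral_Ici_eq_integral_Ioi,
      integral_Ioi_rpow_of_lt (by linarith) zero_lt_one, one_rpow]
    rw [show -1 - s + 1 = -s by ring]; field_simp
  rw [← Set.Ioo_union_Ici_eq_Ioi (zero_lt_one (α := ℝ))]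
  refine ⟨hi.union hi2, ?_⟩
  rw [setIntegral_union ?_ measurableSet_Ici hi hi2, hv, hv2]
  · ring
  · exact Set.disjoint_left.mpr fun x hx hx1 ↦ (not_lt.mpr (show (1:ℝ) ≤ x from hx1)) hx.2

/-- The Gaussian convolution semigroup on `ℝ^d`, normalised so that
`heat t = (π t)^{-d/2} exp(-‖x‖² / t)`. -/
def heat {d : ℕ} (t : ℝ) (x : Euc d) : ℝ :=
  (π * t) ^ (-(d:ℝ) / 2) * exp (-‖x‖ ^ 2 / t)

section Heat

variable {d : ℕ}

lemma heat_pos {t : ℝ} (ht : 0 < t) (x : Euc d) : 0 < heat t x := by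
  unfold heat; positivity

@[fun_prop]
lemma Measurable.heat {α : Type*} [MeasurableSpace α] {f : α → ℝ} {g : α → Euc d}
    (hf : Measurable f) (hg : Measurable g) : Measurable fun a ↦ heat (f a) (g a) := by
  unfold _root_.heat; fun_prop

lemma heat_neg (t : ℝ) (x : Euc d) : heat t (-x) = heat t x := by simp [heat]

lemma heat_sub_comm (t : ℝ) (x y : Euc d) : heat t (x - y) = heat t (y - x) := by
  rw [← heat_neg, neg_sub]

lemma heat_mul_heat {τ t : ℝ} (hτ : 0 < τ) (ht : 0 < t) (x z : Euc d) :
    heat τ (x - z) * heat t z =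
      heat (τ + t) x * ((π / ((τ + t) / (τ * t))) ^ (-(d:ℝ) / 2) *
        exp (-((τ + t) / (τ * t)) * ‖z - (t / (τ + t)) • x‖ ^ 2)) := by
  have hs : 0 < τ + t := by positivity
  have hexp : -‖x - z‖ ^ 2 / τ + -‖z‖ ^ 2 / t =
      -‖x‖ ^ 2 / (τ + t) + -((τ + t) / (τ * t)) * ‖z - (t / (τ + t)) • x‖ ^ 2 := by
    rw [norm_sub_sq_real, norm_sub_sq_real, norm_smul, inner_smul_right, real_inner_comm z x,
      Real.norm_of_nonneg (by positivity)]
    field_simp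
    ring
  unfold heat
  calc _ = ((π * τ) ^ (-(d:ℝ) / 2) * (π * t) ^ (-(d:ℝ) / 2)) *
        (exp (-‖x - z‖ ^ 2 / τ) * exp (-‖z‖ ^ 2 / t)) := by ring
    _ = ((π * (τ + t)) ^ (-(d:ℝ) / 2) * (π / ((τ + t) / (τ * t))) ^ (-(d:ℝ) / 2)) *
        (exp (-‖x‖ ^ 2 / (τ + t)) *
          exp (-((τ + t) / (τ * t)) * ‖z - (t / (τ + t)) • x‖ ^ 2)) := by
      rw [← exp_add, hexp, exp_add, ← mul_rpow (by positivity) (by positivity),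
        ← mul_rpow (by positivity) (by positivity)]
      congr 2
      field_simp
    _ = _ := by ring

lemma integrable_exp_neg_mul_norm_sub_sq {b : ℝ} (hb : 0 < b) (c : Euc d) :
    Integrable fun z : Euc d ↦ exp (-b * ‖z - c‖ ^ 2) := by
  have h : Integrable fun z : Euc d ↦ exp (-b * ‖z‖ ^ 2) := by
    by_contra hni
    have := GaussianFourier.integral_rexp_neg_mul_sq_norm (V := Euc d) hb
    rw [integral_undef hni] at this
    have : 0 < (π / b) ^ ((Module.finrank ℝ (Euc d) : ℝ) / 2) := by positivity
    linarith
  exact h.comp_sub_right c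

/-- The semigroup property of the Gaussian kernel. -/
lemma lintegral_heat_mul_heat {τ t : ℝ} (hτ : 0 < τ) (ht : 0 < t) (x : Euc d) :
    ∫⁻ z : Euc d, ENNReal.ofReal (heat τ (x - z) * heat t z) =
      ENNReal.ofReal (heat (τ + t) x) := by
  have hb : 0 < (τ + t) / (τ * t) := by positivity
  simp_rw [heat_mul_heat hτ ht]
  rw [← ofReal_integral_eq_lintegral_ofReal
    (((integrable_exp_neg_mul_norm_sub_sq hb _).const_mul _).const_mul _)
    (ae_of_all _ fun z ↦ by have := heat_pos (add_pos hτ ht) x; positivity)]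
  rw [integral_const_mul, integral_const_mul,
    integral_sub_right_eq_self (fun z : Euc d ↦ exp (-((τ + t) / (τ * t)) * ‖z‖ ^ 2)),
    GaussianFourier.integral_rexp_neg_mul_sq_norm hb, ← rpow_add (by positivity)]
  simp [neg_div]

/-- Riesz potentials as Gaussian averages. -/
lemma integral_heat_mul_rpow {β : ℝ} (hβ : β < (d:ℝ) / 2) {x : Euc d} (hx : x ≠ 0) :
    IntegrableOn (fun t : ℝ ↦ heat t x * t ^ (β - 1)) (Set.Ioi 0) ∧
    ∫ t in Set.Ioi (0:ℝ), heat t x * t ^ (β - 1) =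
      π ^ (-(d:ℝ) / 2) * Gamma ((d:ℝ) / 2 - β) * ‖x‖ ^ (2 * β - d) := by
  have hp : 0 < (d:ℝ) / 2 - β := by linarith
  have hn : 0 < ‖x‖ := norm_pos_iff.mpr hx
  set g : ℝ → ℝ := fun l ↦ π ^ (-(d:ℝ) / 2) *
    (l ^ ((d:ℝ) / 2 - β - 1) * exp (-(‖x‖ ^ 2 * l))) with hg
  have hgv : ∫ l in Set.Ioi (0:ℝ), g l =
      π ^ (-(d:ℝ) / 2) * Gamma ((d:ℝ) / 2 - β) * ‖x‖ ^ (2 * β - d) := by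
    rw [hg, integral_const_mul, integral_rpow_mul_exp_neg_mul_Ioi hp (by positivity),
      one_div, ← rpow_natCast, ← rpow_neg hn.le, ← rpow_mul hn.le]
    rw [show -((2:ℕ):ℝ) * ((d:ℝ) / 2 - β) = 2 * β - d by push_cast; ring]
    ring
  have hgi : IntegrableOn g (Set.Ioi 0) := by
    by_contra hni
    rw [integral_undef hni] at hgv
    have : 0 < π ^ (-(d:ℝ) / 2) * Gamma ((d:ℝ) / 2 - β) * ‖x‖ ^ (2 * β - d) := by
      have := Gamma_pos_of_pos hp; positivity
    linarith
  have hE : Set.EqOn (fun t : ℝ ↦ (|(-1:ℝ)| * t ^ ((-1:ℝ) - 1)) • g (t ^ (-1:ℝ)))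
      (fun t ↦ heat t x * t ^ (β - 1)) (Set.Ioi 0) := fun t (ht : 0 < t) ↦ by
    simp only [hg, heat, abs_neg, abs_one, one_mul, smul_eq_mul, ← rpow_mul ht.le]
    rw [mul_rpow pi_pos.le ht.le, rpow_neg_one t,
      show -(‖x‖ ^ 2 * t⁻¹) = -‖x‖ ^ 2 / t by ring]
    have : t ^ ((-1:ℝ) - 1) * t ^ (-1 * ((d:ℝ) / 2 - β - 1)) =
        t ^ (-(d:ℝ) / 2) * t ^ (β - 1) := by
      rw [← rpow_add ht, ← rpow_add ht]; congr 1; ring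
    linear_combination (π ^ (-(d:ℝ) / 2) * exp (-‖x‖ ^ 2 / t)) * this
  constructor
  · exact ((integrableOn_Ioi_comp_rpow_iff g (p := -1) (by norm_num)).mpr hgi).congr_fun hE
      measurableSet_Ioi
  · rw [← setIntegral_congr_fun measurableSet_Ioi hE, integral_comp_rpow_Ioi g (by norm_num), hgv]

lemma integrableOn_heat_add_mul_rpow {β τ : ℝ} (hβ0 : 0 < β) (hβ : β < (d:ℝ) / 2) (hτ : 0 < τ)
    (x : Euc d) : IntegrableOn (fun t : ℝ ↦ heat (τ + t) x * t ^ (β - 1)) (Set.Ioi 0) := by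
  have hd : -(d:ℝ) / 2 ≤ 0 := by linarith
  have hm : ∀ S : Set ℝ, AEStronglyMeasurable (fun t : ℝ ↦ heat (τ + t) x * t ^ (β - 1))
      (volume.restrict S) := fun S ↦ by
    apply Measurable.aestronglyMeasurable; fun_prop
  have hb : ∀ t l : ℝ, 0 < t → 0 < l → l ≤ τ + t →
      heat (τ + t) x ≤ (π * l) ^ (-(d:ℝ) / 2) := fun t l ht hl hlt ↦ by
    have h1 : exp (-‖x‖ ^ 2 / (τ + t)) ≤ 1 := by
      rw [exp_le_one_iff, neg_div, neg_nonpos]; positivity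
    have h2 : (π * (τ + t)) ^ (-(d:ℝ) / 2) ≤ (π * l) ^ (-(d:ℝ) / 2) :=
      rpow_le_rpow_of_nonpos (by positivity) (by gcongr) hd
    unfold heat
    exact (mul_le_of_le_one_right (by positivity) h1).trans h2
  rw [← Set.Ioo_union_Ici_eq_Ioi (zero_lt_one (α := ℝ))]
  refine IntegrableOn.union ?_ ?_
  · have hint : IntegrableOn (fun t : ℝ ↦ (π * τ) ^ (-(d:ℝ) / 2) * t ^ (β - 1)) (Set.Ioo 0 1) := by
      have := intervalIntegral.intervalIntegrable_rpow' (a := 0) (b := 1) (r := β - 1) (by linarith)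
      rw [intervalIntegrable_iff_integrableOn_Ioo_of_le zero_le_one] at this
      exact this.const_mul _
    refine hint.mono' (hm _) ?_
    filter_upwards [ae_restrict_mem measurableSet_Ioo] with t ht
    have ht0 := ht.1
    rw [Real.norm_of_nonneg (mul_nonneg (heat_pos (by positivity) x).le (by positivity))]
    gcongr
    exact hb t τ ht0 hτ (by linarith)
  · have hint : IntegrableOn (fun t : ℝ ↦ π ^ (-(d:ℝ) / 2) * t ^ (β - 1 - (d:ℝ) / 2))
        (Set.Ici 1) := by
      rw [integrableOn_Ici_iff_integrableOn_Ioi]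
      exact (integrableOn_Ioi_rpow_of_lt (by linarith) zero_lt_one).const_mul _
    refine hint.mono' (hm _) ?_
    filter_upwards [ae_restrict_mem measurableSet_Ici] with t ht
    have ht0 : 0 < t := zero_lt_one.trans_le ht
    rw [Real.norm_of_nonneg (mul_nonneg (heat_pos (by positivity) x).le (by positivity))]
    calc _ ≤ (π * t) ^ (-(d:ℝ) / 2) * t ^ (β - 1) := by
          gcongr; exact hb t t ht0 ht0 (by linarith)
      _ = _ := by
        rw [mul_rpow pi_pos.le ht0.le, mul_assoc, ← rpow_add ht0]; congr 2; ring

/-- The Gaussian regularisation `heat τ * ‖·‖^{2β-d}` of a Riesz potential. -/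
def heatRiesz (β τ : ℝ) (x : Euc d) : ℝ :=
  π ^ ((d:ℝ) / 2) / Gamma ((d:ℝ) / 2 - β) * ∫ t in Set.Ioi (0:ℝ), heat (τ + t) x * t ^ (β - 1)

lemma measurable_heatRiesz (β : ℝ) :
    Measurable fun p : ℝ × Euc d ↦ heatRiesz β p.1 p.2 := by
  have hm : Measurable fun q : (ℝ × Euc d) × ℝ ↦ heat (q.1.1 + q.2) q.1.2 * q.2 ^ (β - 1) := by
    fun_prop
  exact (hm.stronglyMeasurable.integral_prod_right').measurable.const_mul _

lemma heatRiesz_nonneg {β τ : ℝ} (hβ : β < (d:ℝ) / 2) (hτ : 0 < τ) (x : Euc d) :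
    0 ≤ heatRiesz β τ x := by
  have := Gamma_pos_of_pos (show 0 < (d:ℝ) / 2 - β by linarith)
  refine mul_nonneg (by positivity) (setIntegral_nonneg measurableSet_Ioi fun t ht ↦ ?_)
  have ht0 : 0 < t := ht
  exact mul_nonneg (heat_pos (by positivity) x).le (by positivity)

lemma lintegral_heat_mul_norm_rpow (hd : 0 < d) {β τ : ℝ} (hβ0 : 0 < β) (hβ : β < (d:ℝ) / 2)
    (hτ : 0 < τ) (x : Euc d) :
    ∫⁻ z : Euc d, ENNReal.ofReal (heat τ (x - z) * ‖z‖ ^ (2 * β - d)) =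
      ENNReal.ofReal (heatRiesz β τ x) := by
  have : Nonempty (Fin d) := ⟨⟨0, hd⟩⟩
  have hG := Gamma_pos_of_pos (show 0 < (d:ℝ) / 2 - β by linarith)
  set N := π ^ ((d:ℝ) / 2) / Gamma ((d:ℝ) / 2 - β) with hN
  have hN0 : 0 < N := by positivity
  have hz : ∀ᵐ z : Euc d, ENNReal.ofReal (heat τ (x - z) * ‖z‖ ^ (2 * β - d)) =
      ENNReal.ofReal N * ∫⁻ t in Set.Ioi (0:ℝ),
        ENNReal.ofReal (heat τ (x - z) * heat t z) * ENNReal.ofReal (t ^ (β - 1)) := by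
    filter_upwards [compl_mem_ae_iff.mpr (measure_singleton (0 : Euc d))] with z hz0
    obtain ⟨hi, hv⟩ := integral_heat_mul_rpow hβ (show z ≠ 0 from hz0)
    have hh := heat_pos hτ (x - z)
    have h1 : heat τ (x - z) * ‖z‖ ^ (2 * β - d) =
        N * (heat τ (x - z) * ∫ t in Set.Ioi (0:ℝ), heat t z * t ^ (β - 1)) := by
      have hne := hG.ne'
      rw [hv, hN, neg_div, rpow_neg pi_pos.le]
      generalize Gamma ((d:ℝ) / 2 - β) = G at hne
      field_simp
    rw [h1, ENNReal.ofReal_mul hN0.le, ENNReal.ofReal_mul hh.le,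
      ofReal_integral_eq_lintegral_ofReal hi, ← lintegral_const_mul' _ _ ENNReal.ofReal_ne_top]
    · congr 1
      refine setLIntegral_congr_fun measurableSet_Ioi fun t (ht : 0 < t) ↦ ?_
      have := heat_pos ht z
      rw [ENNReal.ofReal_mul this.le, ENNReal.ofReal_mul hh.le, mul_assoc]
    · filter_upwards [ae_restrict_mem measurableSet_Ioi] with t ht
      have ht0 : 0 < t := ht
      exact mul_nonneg (heat_pos ht0 z).le (by positivity)
  rw [lintegral_congr_ae hz, lintegral_const_mul' _ _ ENNReal.ofReal_ne_top,
    lintegral_lintegral_swap (by apply Measurable.aemeasurable; fun_prop), heatRiesz,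
    ENNReal.ofReal_mul hN0.le,
    ofReal_integral_eq_lintegral_ofReal (integrableOn_heat_add_mul_rpow hβ0 hβ hτ x)]
  · congr 1
    refine setLIntegral_congr_fun measurableSet_Ioi fun t (ht : 0 < t) ↦ ?_
    rw [lintegral_mul_const' _ _ ENNReal.ofReal_ne_top, lintegral_heat_mul_heat hτ ht,
      ENNReal.ofReal_mul (heat_pos (by positivity) x).le]
  · filter_upwards [ae_restrict_mem measurableSet_Ioi] with t ht
    have ht0 : 0 < t := ht
    exact mul_nonneg (heat_pos (by positivity) x).le (by positivity)

end Heat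

lemma setIntegral_Ioi_comp_div {f : ℝ → ℝ} {t : ℝ} (ht : 0 < t) :
    ∫ τ in Set.Ioi (0:ℝ), f (τ / t) = t * ∫ σ in Set.Ioi (0:ℝ), f σ := by
  have := integral_comp_mul_left_Ioi f 0 (inv_pos.mpr ht)
  simp only [mul_zero, inv_inv, smul_eq_mul] at this
  rw [← this]
  simp_rw [div_eq_inv_mul]

lemma integrableOn_Ioi_comp_div {f : ℝ → ℝ} (hf : IntegrableOn f (Set.Ioi 0)) {t : ℝ}
    (ht : 0 < t) : IntegrableOn (fun τ ↦ f (τ / t)) (Set.Ioi 0) := by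
  have := (integrableOn_Ioi_comp_mul_left_iff f 0 (inv_pos.mpr ht)).mpr (by simpa using hf)
  simpa only [div_eq_inv_mul] using this

lemma hardyProfile_div {s β t τ : ℝ} (ht : 0 < t) (hτ : 0 < τ) :
    t ^ (β - 1) * t ^ (-1 - s) * hardyProfile s β (τ / t) =
      τ ^ (-1 - s) * (t ^ (β - 1) - if τ < t then (t - τ) ^ (β - 1) else 0) := by
  unfold hardyProfile
  rw [div_rpow hτ.le ht.le]
  simp only [div_lt_one ht]
  have h1 : t ^ (-1 - s) ≠ 0 := (rpow_pos_of_pos ht _).ne'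
  split_ifs with h
  · rw [show 1 - τ / t = (t - τ) / t by field_simp, div_rpow (by linarith) ht.le]
    have h2 : t ^ (β - 1) ≠ 0 := (rpow_pos_of_pos ht _).ne'
    field_simp
  · field_simp
    ring

@[fun_prop]
lemma measurable_hardyProfile (s β : ℝ) : Measurable (hardyProfile s β) := by
  unfold hardyProfile
  refine Measurable.mul (by fun_prop) (Measurable.const_sub ?_ _)
  exact Measurable.ite (measurableSet_lt measurable_id measurable_const) (by fun_prop) (by fun_prop)

section Heat

variable {d : ℕ}

lemma setIntegral_heat_mul_ite {β τ : ℝ} (hβ0 : 0 < β) (hβ : β < (d:ℝ) / 2) (hτ : 0 < τ)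
    (x : Euc d) :
    IntegrableOn (fun t ↦ heat t x * if τ < t then (t - τ) ^ (β - 1) else 0) (Set.Ioi 0) ∧
    ∫ t in Set.Ioi (0:ℝ), heat t x * (if τ < t then (t - τ) ^ (β - 1) else 0) =
      ∫ t in Set.Ioi (0:ℝ), heat (τ + t) x * t ^ (β - 1) := by
  set φ : ℝ → ℝ := (Set.Ioi (0:ℝ)).indicator fun t ↦ heat (τ + t) x * t ^ (β - 1) with hφ
  have h1 : (Set.Ioi (0:ℝ)).indicator
      (fun t ↦ heat t x * if τ < t then (t - τ) ^ (β - 1) else 0) = fun t ↦ φ (t - τ) := by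
    funext t
    simp only [hφ, Set.indicator_apply, Set.mem_Ioi, sub_pos, add_sub_cancel]
    by_cases h : τ < t
    · simp [h, hτ.trans h]
    · simp [h]
  have hi : Integrable φ :=
    (integrable_indicator_iff measurableSet_Ioi).mpr (integrableOn_heat_add_mul_rpow hβ0 hβ hτ x)
  constructor
  · rw [← integrable_indicator_iff measurableSet_Ioi, h1]
    exact hi.comp_sub_right τ
  · rw [← integral_indicator measurableSet_Ioi, h1, integral_sub_right_eq_self φ,
      hφ, integral_indicator measurableSet_Ioi]

/-- The action of `(-Δ)^s` on a Riesz potential, in semigroup form. -/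
lemma integral_heatRiesz {s β : ℝ} (hs0 : 0 < s) (hs1 : s < 1) (hsβ : s ≤ β)
    (hβ : β < (d:ℝ) / 2) {x : Euc d} (hx : x ≠ 0) :
    IntegrableOn (fun τ ↦ τ ^ (-1 - s) * (1 - heatRiesz β τ x / ‖x‖ ^ (2 * β - d))) (Set.Ioi 0) ∧
    ∫ τ in Set.Ioi (0:ℝ), τ ^ (-1 - s) * (1 - heatRiesz β τ x / ‖x‖ ^ (2 * β - d)) =
      Gamma (1 - s) * Gamma β / (s * Gamma (β - s)) *
        (Gamma ((d:ℝ) / 2 - β + s) / Gamma ((d:ℝ) / 2 - β)) * ‖x‖ ^ (-(2 * s)) ∧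
    ∫ τ in Set.Ioi (0:ℝ), |τ ^ (-1 - s) * (1 - heatRiesz β τ x / ‖x‖ ^ (2 * β - d))| ≤
      (∫ σ in Set.Ioi (0:ℝ), |hardyProfile s β σ|) *
        (Gamma ((d:ℝ) / 2 - β + s) / Gamma ((d:ℝ) / 2 - β)) * ‖x‖ ^ (-(2 * s)) := by
  have hβ0 : 0 < β := hs0.trans_le hsβ
  have hn : 0 < ‖x‖ := norm_pos_iff.mpr hx
  have hG := Gamma_pos_of_pos (show 0 < (d:ℝ) / 2 - β by linarith)
  set N := π ^ ((d:ℝ) / 2) / Gamma ((d:ℝ) / 2 - β) with hN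
  have hN0 : 0 < N := by positivity
  obtain ⟨hki, hkv⟩ := integral_hardyProfile hs0 hs1 hsβ
  obtain ⟨hPi, hPv⟩ := integral_heat_mul_rpow hβ hx
  obtain ⟨hQi, hQv⟩ := integral_heat_mul_rpow (β := β - s) (by linarith) hx
  set μ := volume.restrict (Set.Ioi (0:ℝ)) with hμ
  set A : ℝ → ℝ := fun t ↦ heat t x * (t ^ (β - 1) * t ^ (-1 - s)) with hA
  set F : ℝ → ℝ → ℝ := fun t τ ↦ A t * hardyProfile s β (τ / t) with hF
  have hAt : ∀ t, 0 < t → A t * t = heat t x * t ^ (β - s - 1) := fun t ht ↦ by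
    simp only [hA]
    rw [mul_assoc, mul_assoc, ← rpow_add_one ht.ne', ← rpow_add ht]
    congr 2; ring
  have hFint : ∀ t, 0 < t → Integrable (F t) μ := fun t ht ↦
    (integrableOn_Ioi_comp_div hki ht).const_mul _
  have hFv : ∀ t, 0 < t → ∫ τ, F t τ ∂μ =
      heat t x * t ^ (β - s - 1) * ∫ σ, hardyProfile s β σ ∂μ := fun t ht ↦ by
    simp only [hF]
    rw [integral_const_mul, setIntegral_Ioi_comp_div ht, ← mul_assoc, hAt t ht]
  have hFn : ∀ t, 0 < t → ∫ τ, ‖F t τ‖ ∂μ =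
      heat t x * t ^ (β - s - 1) * ∫ σ, |hardyProfile s β σ| ∂μ := fun t ht ↦ by
    have hA0 : 0 ≤ A t := mul_nonneg (heat_pos ht x).le (by positivity)
    simp only [hF, norm_mul, Real.norm_eq_abs, abs_of_nonneg hA0]
    rw [integral_const_mul, setIntegral_Ioi_comp_div (f := fun σ ↦ |hardyProfile s β σ|) ht,
      ← mul_assoc, hAt t ht]
  have hpos : ∀ᵐ t ∂μ, 0 < t := ae_restrict_mem measurableSet_Ioi
  have hFI : Integrable (Function.uncurry F) (μ.prod μ) := by
    rw [integrable_prod_iff (by apply Measurable.aestronglyMeasurable; simp only [hF, hA]; fun_prop)]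
    refine ⟨hpos.mono hFint, ?_⟩
    refine Integrable.congr (hQi.mul_const (∫ σ, |hardyProfile s β σ| ∂μ)) ?_
    filter_upwards [hpos] with t ht
    exact (hFn t ht).symm
  have hinner : ∀ τ, 0 < τ → N * ∫ t, F t τ ∂μ =
      ‖x‖ ^ (2 * β - d) * (τ ^ (-1 - s) * (1 - heatRiesz β τ x / ‖x‖ ^ (2 * β - d))) :=
      fun τ hτ ↦ by
    obtain ⟨hi, hv⟩ := setIntegral_heat_mul_ite hβ0 hβ hτ x
    have h1 : ∫ t, F t τ ∂μ = ∫ t, τ ^ (-1 - s) * (heat t x * t ^ (β - 1) -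
        heat t x * (if τ < t then (t - τ) ^ (β - 1) else 0)) ∂μ := by
      refine setIntegral_congr_fun measurableSet_Ioi fun t (ht : 0 < t) ↦ ?_
      simp only [hF, hA]
      linear_combination heat t x * hardyProfile_div (s := s) (β := β) ht hτ
    have h2 : N * (π ^ (-(d:ℝ) / 2) * Gamma ((d:ℝ) / 2 - β) * ‖x‖ ^ (2 * β - d)) =
        ‖x‖ ^ (2 * β - d) := by
      have hne := hG.ne'
      rw [hN, neg_div, rpow_neg pi_pos.le]
      generalize Gamma ((d:ℝ) / 2 - β) = G at hne
      field_simp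
    have h3 : heatRiesz β τ x = N * ∫ t, heat (τ + t) x * t ^ (β - 1) ∂μ := rfl
    have h4 : 0 < ‖x‖ ^ (2 * β - d) := by positivity
    rw [h1, integral_const_mul, integral_sub hPi hi, hv, hPv, h3]
    generalize ∫ t, heat (τ + t) x * t ^ (β - 1) ∂μ = I
    calc _ = τ ^ (-1 - s) * (N * (π ^ (-(d:ℝ) / 2) * Gamma ((d:ℝ) / 2 - β) *
          ‖x‖ ^ (2 * β - d))) - τ ^ (-1 - s) * (N * I) := by ring
      _ = τ ^ (-1 - s) * ‖x‖ ^ (2 * β - d) - τ ^ (-1 - s) * (N * I) := by rw [h2]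
      _ = _ := by field_simp
  set D : ℝ → ℝ := fun τ ↦ τ ^ (-1 - s) * (1 - heatRiesz β τ x / ‖x‖ ^ (2 * β - d)) with hD
  set c := N / ‖x‖ ^ (2 * β - d) with hc
  have hc0 : 0 < c := by positivity
  have hDe : ∀ τ, 0 < τ → D τ = c * ∫ t, F t τ ∂μ := fun τ hτ ↦ by
    rw [hc, div_mul_eq_mul_div, hinner τ hτ, mul_div_cancel_left₀ _ (by positivity)]
  have hcQ : c * ∫ t, heat t x * t ^ (β - s - 1) ∂μ =
      Gamma ((d:ℝ) / 2 - β + s) / Gamma ((d:ℝ) / 2 - β) * ‖x‖ ^ (-(2 * s)) := by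
    rw [hQv, hc, hN, neg_div, rpow_neg pi_pos.le,
      show 2 * (β - s) - (d:ℝ) = (2 * β - d) + -(2 * s) by ring, rpow_add hn,
      show (d:ℝ) / 2 - (β - s) = (d:ℝ) / 2 - β + s by ring]
    have hne := hG.ne'
    generalize Gamma ((d:ℝ) / 2 - β) = G at hne
    field_simp
  have hswap := integral_integral_swap hFI
  have hLv : ∫ τ, ∫ t, F t τ ∂μ ∂μ =
      (∫ t, heat t x * t ^ (β - s - 1) ∂μ) * ∫ σ, hardyProfile s β σ ∂μ := by
    rw [← hswap, integral_congr_ae (hpos.mono hFv), integral_mul_const]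
  refine ⟨?_, ?_, ?_⟩
  · exact (hFI.integral_prod_right.const_mul c).congr (hpos.mono fun τ hτ ↦ (hDe τ hτ).symm)
  · rw [integral_congr_ae (hpos.mono hDe), integral_const_mul, hLv, hkv, ← mul_assoc, hcQ]
    ring
  · have hn2 := integral_integral_swap (f := fun t τ ↦ ‖F t τ‖) hFI.norm
    calc ∫ τ, |D τ| ∂μ = ∫ τ, c * ‖∫ t, F t τ ∂μ‖ ∂μ := by
          refine integral_congr_ae (hpos.mono fun τ hτ ↦ ?_)
          simp only []
          rw [hDe τ hτ, abs_mul, abs_of_pos hc0, Real.norm_eq_abs]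
      _ = c * ∫ τ, ‖∫ t, F t τ ∂μ‖ ∂μ := integral_const_mul _ _
      _ ≤ c * ∫ τ, ∫ t, ‖F t τ‖ ∂μ ∂μ := by
          refine mul_le_mul_of_nonneg_left ?_ hc0.le
          exact integral_mono hFI.integral_prod_right.norm hFI.norm.integral_prod_right
            fun τ ↦ norm_integral_le_integral_norm _
      _ = c * ((∫ t, heat t x * t ^ (β - s - 1) ∂μ) * ∫ σ, |hardyProfile s β σ| ∂μ) := by
          rw [← hn2, integral_congr_ae (hpos.mono hFn), integral_mul_const]
      _ = _ := by rw [← mul_assoc, hcQ]; ring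

lemma ofReal_integral_le_lintegral {α : Type*} [MeasurableSpace α] {μ : Measure α} {f : α → ℝ}
    (hf : Integrable f μ) : ENNReal.ofReal (∫ a, f a ∂μ) ≤ ∫⁻ a, ENNReal.ofReal (f a) ∂μ := by
  rw [integral_eq_lintegral_pos_part_sub_lintegral_neg_part hf]
  refine (ENNReal.ofReal_le_ofReal (sub_le_self _ ENNReal.toReal_nonneg)).trans ?_
  exact ENNReal.ofReal_toReal_le

/-- The relative Gaussian average of `‖· - c‖^{2β-d}` at the point `η`. -/
def heatRatio (β : ℝ) (c : Euc d) (τ : ℝ) (η : Euc d) : ℝ :=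
  heatRiesz β τ (η - c) / ‖η - c‖ ^ (2 * β - d)

lemma measurable_heatRatio (β : ℝ) (c : Euc d) :
    Measurable fun p : ℝ × Euc d ↦ heatRatio β c p.1 p.2 := by
  have h : Measurable fun p : ℝ × Euc d ↦ (p.1, p.2 - c) := by fun_prop
  exact ((measurable_heatRiesz β).comp h).div (by fun_prop)

lemma heatRatio_nonneg {β τ : ℝ} (hβ : β < (d:ℝ) / 2) (hτ : 0 < τ) (c η : Euc d) :
    0 ≤ heatRatio β c τ η :=
  div_nonneg (heatRiesz_nonneg hβ hτ _) (by positivity)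

lemma lintegral_heat_mul_norm_sub_rpow (hd : 0 < d) {β τ : ℝ} (hβ0 : 0 < β)
    (hβ : β < (d:ℝ) / 2) (hτ : 0 < τ) (c η : Euc d) :
    ∫⁻ ζ : Euc d, ENNReal.ofReal (heat τ (η - ζ) * ‖ζ - c‖ ^ (2 * β - d)) =
      ENNReal.ofReal (heatRiesz β τ (η - c)) := by
  rw [← lintegral_heat_mul_norm_rpow hd hβ0 hβ hτ, ← lintegral_sub_right_eq_self
    (fun z : Euc d ↦ ENNReal.ofReal (heat τ (η - c - z) * ‖z‖ ^ (2 * β - d))) c]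
  simp

lemma integrable_mul_one_sub_heatRatio {s β : ℝ} (hs0 : 0 < s) (hs1 : s < 1) (hsβ : s ≤ β)
    (hβ : β < (d:ℝ) / 2) (hd : 0 < d) (c : Euc d) {ρ : Euc d → ℝ} (hρm : Measurable ρ)
    (hρ0 : ∀ η, 0 ≤ ρ η) (hρ : Integrable fun η ↦ ρ η * ‖η - c‖ ^ (-(2 * s))) :
    Integrable (fun p : ℝ × Euc d ↦ ρ p.2 * (p.1 ^ (-1 - s) * (1 - heatRatio β c p.1 p.2)))
      ((volume.restrict (Set.Ioi 0)).prod volume) ∧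
    ∫ τ in Set.Ioi (0:ℝ), ∫ η, ρ η * (τ ^ (-1 - s) * (1 - heatRatio β c τ η)) =
      Gamma (1 - s) * Gamma β / (s * Gamma (β - s)) *
        (Gamma ((d:ℝ) / 2 - β + s) / Gamma ((d:ℝ) / 2 - β)) *
        ∫ η, ρ η * ‖η - c‖ ^ (-(2 * s)) := by
  have : Nonempty (Fin d) := ⟨⟨0, hd⟩⟩
  have hm : Measurable
      fun p : ℝ × Euc d ↦ ρ p.2 * (p.1 ^ (-1 - s) * (1 - heatRatio β c p.1 p.2)) := by
    have := measurable_heatRatio β c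
    fun_prop
  have hne : ∀ᵐ η : Euc d, η - c ≠ 0 := by
    filter_upwards [compl_mem_ae_iff.mpr (measure_singleton c)] with η hη
    exact sub_ne_zero.mpr hη
  have hI : Integrable (fun p : ℝ × Euc d ↦ ρ p.2 * (p.1 ^ (-1 - s) * (1 - heatRatio β c p.1 p.2)))
      ((volume.restrict (Set.Ioi 0)).prod volume) := by
    rw [integrable_prod_iff' hm.aestronglyMeasurable]
    refine ⟨?_, ?_⟩
    · filter_upwards [hne] with η hη
      exact (integral_heatRiesz hs0 hs1 hsβ hβ hη).1.const_mul _
    · refine Integrable.mono' (hρ.const_mul ((∫ σ in Set.Ioi (0:ℝ), |hardyProfile s β σ|) *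
        (Gamma ((d:ℝ) / 2 - β + s) / Gamma ((d:ℝ) / 2 - β)))) ?_ ?_
      · exact (hm.norm.stronglyMeasurable.integral_prod_left').aestronglyMeasurable
      · filter_upwards [hne] with η hη
        rw [Real.norm_of_nonneg (integral_nonneg fun _ ↦ norm_nonneg _)]
        have hn : ∀ X : ℝ, ‖ρ η * X‖ = ρ η * |X| := fun X ↦ by
          rw [norm_mul, Real.norm_of_nonneg (hρ0 η), Real.norm_eq_abs]
        simp only [hn]
        rw [integral_const_mul]
        have := mul_le_mul_of_nonneg_left (integral_heatRiesz hs0 hs1 hsβ hβ hη).2.2 (hρ0 η)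
        refine this.trans_eq ?_
        ring
  refine ⟨hI, ?_⟩
  rw [integral_integral_swap hI, ← integral_const_mul]
  refine integral_congr_ae ?_
  filter_upwards [hne] with η hη
  rw [integral_const_mul]
  have := (integral_heatRiesz hs0 hs1 hsβ hβ hη).2.1
  unfold heatRatio
  rw [this]
  ring

lemma two_mul_mul_le_of_weights {p q P Q g k : ℝ} (hg : 0 < g) (hk : 0 < k) :
    p * q * (P ^ 2 + Q ^ 2) ≤
      p * q * (P - Q) ^ 2 + (p ^ 2 * P ^ 2 * (k / g) + q ^ 2 * Q ^ 2 * (g / k)) := by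
  have h : p ^ 2 * P ^ 2 * (k / g) + q ^ 2 * Q ^ 2 * (g / k) - 2 * (p * q * P * Q) =
      (p * P * k - q * Q * g) ^ 2 / (g * k) := by
    field_simp; ring
  have : 0 ≤ (p * P * k - q * Q * g) ^ 2 / (g * k) := by positivity
  linarith

lemma two_mul_lintegral_le_of_symm {α : Type*} [MeasurableSpace α] {μ : Measure α} [SFinite μ]
    {F G A : α → α → ENNReal} (hF : Measurable (Function.uncurry F))
    (hG : Measurable (Function.uncurry G)) (hA : Measurable (Function.uncurry A))
    (hle : ∀ᵐ η ∂μ, ∀ᵐ ζ ∂μ, F η ζ + F ζ η ≤ A η ζ + (G η ζ + G ζ η)) :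
    2 * ∫⁻ η, ∫⁻ ζ, F η ζ ∂μ ∂μ ≤
      (∫⁻ η, ∫⁻ ζ, A η ζ ∂μ ∂μ) + 2 * ∫⁻ η, ∫⁻ ζ, G η ζ ∂μ ∂μ := by
  have hFs : ∫⁻ η, ∫⁻ ζ, F ζ η ∂μ ∂μ = ∫⁻ η, ∫⁻ ζ, F η ζ ∂μ ∂μ :=
    lintegral_lintegral_swap (f := fun η ζ ↦ F ζ η) (hF.comp measurable_swap).aemeasurable
  have hGs : ∫⁻ η, ∫⁻ ζ, G ζ η ∂μ ∂μ = ∫⁻ η, ∫⁻ ζ, G η ζ ∂μ ∂μ :=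
    lintegral_lintegral_swap (f := fun η ζ ↦ G ζ η) (hG.comp measurable_swap).aemeasurable
  have hF1 : ∀ η, Measurable (F η) := fun η ↦ hF.comp measurable_prodMk_left
  have hG1 : ∀ η, Measurable (G η) := fun η ↦ hG.comp measurable_prodMk_left
  have hA1 : ∀ η, Measurable (A η) := fun η ↦ hA.comp measurable_prodMk_left
  have hF2 : Measurable fun η ↦ ∫⁻ ζ, F η ζ ∂μ := hF.lintegral_prod_right'
  have hG2 : Measurable fun η ↦ ∫⁻ ζ, G η ζ ∂μ := hG.lintegral_prod_right'
  have hA2 : Measurable fun η ↦ ∫⁻ ζ, A η ζ ∂μ := hA.lintegral_prod_right'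
  calc 2 * ∫⁻ η, ∫⁻ ζ, F η ζ ∂μ ∂μ
      = (∫⁻ η, ∫⁻ ζ, F η ζ ∂μ ∂μ) + ∫⁻ η, ∫⁻ ζ, F ζ η ∂μ ∂μ := by rw [hFs, two_mul]
    _ = ∫⁻ η, ∫⁻ ζ, (F η ζ + F ζ η) ∂μ ∂μ := by
        rw [← lintegral_add_left hF2]
        exact lintegral_congr fun η ↦ (lintegral_add_left (hF1 η) _).symm
    _ ≤ ∫⁻ η, ∫⁻ ζ, (A η ζ + (G η ζ + G ζ η)) ∂μ ∂μ :=
        lintegral_mono_ae (hle.mono fun η hη ↦ lintegral_mono_ae hη)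
    _ = (∫⁻ η, ∫⁻ ζ, A η ζ ∂μ ∂μ) +
        ((∫⁻ η, ∫⁻ ζ, G η ζ ∂μ ∂μ) + ∫⁻ η, ∫⁻ ζ, G ζ η ∂μ ∂μ) := by
        rw [← lintegral_add_left hG2, ← lintegral_add_left hA2]
        refine lintegral_congr fun η ↦ ?_
        rw [lintegral_add_left (hA1 η), lintegral_add_left (hG1 η)]
    _ = _ := by rw [hGs, two_mul]

/-- The ground state inequality for the Gaussian kernel at a fixed time. -/
lemma lintegral_heatRatio_le (hd : 0 < d) {s β τ : ℝ} (hs0 : 0 < s) (hs : s < (d:ℝ) / 2)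
    (hβ0 : 0 < β) (hβ : β < (d:ℝ) / 2) (hτ : 0 < τ) (b c : Euc d) {U : Euc d → ℝ}
    (hU : Measurable U) :
    2 * ∫⁻ η, ENNReal.ofReal ((‖η - b‖ ^ (2 * s - d)) ^ 2 * U η ^ 2 * heatRatio s b τ η) ≤
      (∫⁻ η, ∫⁻ ζ, ENNReal.ofReal (heat τ (η - ζ) *
        (‖η - b‖ ^ (2 * s - d) * ‖ζ - b‖ ^ (2 * s - d) * (U η - U ζ) ^ 2))) +
      2 * ∫⁻ η, ENNReal.ofReal
        ((‖η - b‖ ^ (2 * s - d)) ^ 2 * U η ^ 2 * heatRatio β c τ η) := by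
  have : Nonempty (Fin d) := ⟨⟨0, hd⟩⟩
  have hne : ∀ e : Euc d, ∀ᵐ η : Euc d, 0 < ‖η - e‖ := fun e ↦ by
    filter_upwards [compl_mem_ae_iff.mpr (measure_singleton e)] with η hη
    exact norm_pos_iff.mpr (sub_ne_zero.mpr hη)
  set h : Euc d → ℝ := fun η ↦ ‖η - b‖ ^ (2 * s - d) with hh
  set g : Euc d → ℝ := fun η ↦ ‖η - c‖ ^ (2 * β - d) with hg
  have hhm : Measurable h := by fun_prop
  have hgm : Measurable g := by fun_prop
  have hh0 : ∀ η, 0 ≤ h η := fun η ↦ by positivity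
  have hg0 : ∀ η, 0 ≤ g η := fun η ↦ by positivity
  set F : Euc d → Euc d → ENNReal := fun η ζ ↦
    ENNReal.ofReal (heat τ (η - ζ) * (h η * h ζ * U η ^ 2)) with hF
  set G : Euc d → Euc d → ENNReal := fun η ζ ↦
    ENNReal.ofReal (heat τ (η - ζ) * (h η ^ 2 * U η ^ 2 * (g ζ / g η))) with hG
  set A : Euc d → Euc d → ENNReal := fun η ζ ↦
    ENNReal.ofReal (heat τ (η - ζ) * (h η * h ζ * (U η - U ζ) ^ 2)) with hA
  have hFm : Measurable (Function.uncurry F) := by simp only [hF, Function.uncurry_def]; fun_prop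
  have hGm : Measurable (Function.uncurry G) := by simp only [hG, Function.uncurry_def]; fun_prop
  have hAm : Measurable (Function.uncurry A) := by simp only [hA, Function.uncurry_def]; fun_prop
  have hFv : ∫⁻ η, ∫⁻ ζ, F η ζ = ∫⁻ η, ENNReal.ofReal (h η ^ 2 * U η ^ 2 * heatRatio s b τ η) := by
    refine lintegral_congr_ae ?_
    filter_upwards [hne b] with η hη
    have h1 : ∀ ζ, F η ζ = ENNReal.ofReal (h η * U η ^ 2) *
        ENNReal.ofReal (heat τ (η - ζ) * ‖ζ - b‖ ^ (2 * s - d)) := fun ζ ↦ by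
      rw [← ENNReal.ofReal_mul (mul_nonneg (hh0 η) (sq_nonneg _))]
      simp only [hF, hh]
      congr 1; ring
    have h2 : h η ≠ 0 := (rpow_pos_of_pos hη _).ne'
    simp_rw [h1]
    rw [lintegral_const_mul' _ _ ENNReal.ofReal_ne_top,
      lintegral_heat_mul_norm_sub_rpow hd hs0 hs hτ,
      ← ENNReal.ofReal_mul (mul_nonneg (hh0 η) (sq_nonneg _))]
    congr 1
    change _ = h η ^ 2 * U η ^ 2 * (heatRiesz s τ (η - b) / h η)
    field_simp
  have hGv : ∫⁻ η, ∫⁻ ζ, G η ζ = ∫⁻ η, ENNReal.ofReal (h η ^ 2 * U η ^ 2 * heatRatio β c τ η) := by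
    refine lintegral_congr fun η ↦ ?_
    have h0 : 0 ≤ h η ^ 2 * U η ^ 2 / g η := by have := hg0 η; positivity
    have h1 : ∀ ζ, G η ζ = ENNReal.ofReal (h η ^ 2 * U η ^ 2 / g η) *
        ENNReal.ofReal (heat τ (η - ζ) * ‖ζ - c‖ ^ (2 * β - d)) := fun ζ ↦ by
      rw [← ENNReal.ofReal_mul h0]
      simp only [hG, hg]
      congr 1; ring
    simp_rw [h1]
    rw [lintegral_const_mul' _ _ ENNReal.ofReal_ne_top,
      lintegral_heat_mul_norm_sub_rpow hd hβ0 hβ hτ, ← ENNReal.ofReal_mul h0]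
    congr 1
    change _ = h η ^ 2 * U η ^ 2 * (heatRiesz β τ (η - c) / g η)
    ring
  have hpt : ∀ η ζ, 0 < ‖η - c‖ → 0 < ‖ζ - c‖ →
      F η ζ + F ζ η ≤ A η ζ + (G η ζ + G ζ η) := fun η ζ hη hζ ↦ by
    have hq := heat_pos hτ (η - ζ)
    have hgη : 0 < g η := rpow_pos_of_pos hη _
    have hgζ : 0 < g ζ := rpow_pos_of_pos hζ _
    have := hh0 η
    have := hh0 ζ
    simp only [hF, hG, hA, heat_sub_comm τ ζ η]
    rw [← ENNReal.ofReal_add (by positivity) (by positivity),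
      ← ENNReal.ofReal_add (by positivity) (by positivity),
      ← ENNReal.ofReal_add (by positivity) (by positivity)]
    refine ENNReal.ofReal_le_ofReal ?_
    have key := mul_le_mul_of_nonneg_left (two_mul_mul_le_of_weights (p := h η) (q := h ζ)
      (P := U η) (Q := U ζ) hgη hgζ) hq.le
    linarith
  rw [← hFv, ← hGv]
  refine two_mul_lintegral_le_of_symm hFm hGm hAm ?_
  filter_upwards [hne c] with η hη
  filter_upwards [hne c] with ζ hζ
  exact hpt η ζ hη hζ

/-- The kernel of the fractional Laplacian as a superposition of Gaussians. -/
lemma lintegral_rpow_mul_heat {s : ℝ} (hs0 : 0 < s) {x : Euc d} (hx : x ≠ 0) :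
    ∫⁻ τ in Set.Ioi (0:ℝ), ENNReal.ofReal (τ ^ (-1 - s) * heat τ x) =
      ENNReal.ofReal (π ^ (-(d:ℝ) / 2) * Gamma ((d:ℝ) / 2 + s) / ‖x‖ ^ ((d:ℝ) + 2 * s)) := by
  have hd0 : (0:ℝ) ≤ d := Nat.cast_nonneg d
  obtain ⟨hi, hv⟩ := integral_heat_mul_rpow (d := d) (β := -s) (by linarith) hx
  have he : -s - 1 = -1 - s := by ring
  rw [he] at hi hv
  simp_rw [mul_comm _ (heat _ x)]
  rw [← ofReal_integral_eq_lintegral_ofReal hi, hv, sub_neg_eq_add,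
    show 2 * -s - (d:ℝ) = -((d:ℝ) + 2 * s) by ring, rpow_neg (norm_nonneg x)]
  · rfl
  · filter_upwards [ae_restrict_mem measurableSet_Ioi] with t ht
    have ht0 : 0 < t := ht
    exact mul_nonneg (heat_pos ht0 x).le (by positivity)

lemma lintegral_heat_energy (hd : 0 < d) {s : ℝ} (hs0 : 0 < s) {W : Euc d → Euc d → ℝ}
    (hW : Measurable (Function.uncurry W)) :
    ∫⁻ τ in Set.Ioi (0:ℝ), ENNReal.ofReal (τ ^ (-1 - s)) *
        ∫⁻ η, ∫⁻ ζ, ENNReal.ofReal (heat τ (η - ζ) * W η ζ) =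
      ENNReal.ofReal (π ^ (-(d:ℝ) / 2) * Gamma ((d:ℝ) / 2 + s)) *
        ∫⁻ η, ∫⁻ ζ, ENNReal.ofReal (W η ζ / ‖η - ζ‖ ^ ((d:ℝ) + 2 * s)) := by
  have : Nonempty (Fin d) := ⟨⟨0, hd⟩⟩
  have hm : Measurable fun p : (ℝ × Euc d) × Euc d ↦ ENNReal.ofReal (p.1.1 ^ (-1 - s)) *
      ENNReal.ofReal (heat p.1.1 (p.1.2 - p.2) * W p.1.2 p.2) := by
    have : Measurable fun p : (ℝ × Euc d) × Euc d ↦ W p.1.2 p.2 :=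
      hW.comp (by fun_prop : Measurable fun p : (ℝ × Euc d) × Euc d ↦ (p.1.2, p.2))
    fun_prop
  have h1 : ∀ τ : ℝ, ENNReal.ofReal (τ ^ (-1 - s)) *
        ∫⁻ η, ∫⁻ ζ, ENNReal.ofReal (heat τ (η - ζ) * W η ζ) =
      ∫⁻ η, ∫⁻ ζ, ENNReal.ofReal (τ ^ (-1 - s)) *
        ENNReal.ofReal (heat τ (η - ζ) * W η ζ) := fun τ ↦ by
    rw [← lintegral_const_mul' _ _ ENNReal.ofReal_ne_top]
    exact lintegral_congr fun η ↦ (lintegral_const_mul' _ _ ENNReal.ofReal_ne_top).symm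
  simp_rw [h1]
  rw [lintegral_lintegral_swap (f := fun (τ : ℝ) (η : Euc d) ↦
    ∫⁻ ζ, ENNReal.ofReal (τ ^ (-1 - s)) * ENNReal.ofReal (heat τ (η - ζ) * W η ζ))
    hm.lintegral_prod_right'.aemeasurable, ← lintegral_const_mul' _ _ ENNReal.ofReal_ne_top]
  refine lintegral_congr fun η ↦ ?_
  rw [lintegral_lintegral_swap (f := fun (τ : ℝ) (ζ : Euc d) ↦
      ENNReal.ofReal (τ ^ (-1 - s)) * ENNReal.ofReal (heat τ (η - ζ) * W η ζ))
    (hm.comp (by fun_prop : Measurable fun q : ℝ × Euc d ↦ ((q.1, η), q.2))).aemeasurable,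
    ← lintegral_const_mul' _ _ ENNReal.ofReal_ne_top]
  refine lintegral_congr_ae ?_
  filter_upwards [compl_mem_ae_iff.mpr (measure_singleton η)] with ζ hζ
  have hx : η - ζ ≠ 0 := sub_ne_zero.mpr (Ne.symm hζ)
  have h2 : ∀ τ ∈ Set.Ioi (0:ℝ), ENNReal.ofReal (τ ^ (-1 - s)) *
      ENNReal.ofReal (heat τ (η - ζ) * W η ζ) =
      ENNReal.ofReal (τ ^ (-1 - s) * heat τ (η - ζ)) * ENNReal.ofReal (W η ζ) := fun τ hτ ↦ by
    have hτ0 : 0 < τ := hτ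
    have := heat_pos hτ0 (η - ζ)
    rw [← ENNReal.ofReal_mul (by positivity), ← ENNReal.ofReal_mul (by positivity), mul_assoc]
  rw [setLIntegral_congr_fun measurableSet_Ioi h2,
    lintegral_mul_const' _ _ ENNReal.ofReal_ne_top, lintegral_rpow_mul_heat hs0 hx]
  have hG := Gamma_pos_of_pos (show 0 < (d:ℝ) / 2 + s by positivity)
  rw [← ENNReal.ofReal_mul (by positivity), ← ENNReal.ofReal_mul (by positivity)]
  congr 1
  ring

lemma ofReal_integral_heatRatio_sub_le (hd : 0 < d) {s β τ : ℝ} (hs0 : 0 < s)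
    (hs : s < (d:ℝ) / 2) (hβ0 : 0 < β) (hβ : β < (d:ℝ) / 2) (hτ : 0 < τ) (b c : Euc d)
    {U : Euc d → ℝ} (hU : Measurable U)
    (hib : Integrable fun η ↦ (‖η - b‖ ^ (2 * s - d)) ^ 2 * U η ^ 2 * heatRatio s b τ η)
    (hic : Integrable fun η ↦ (‖η - b‖ ^ (2 * s - d)) ^ 2 * U η ^ 2 * heatRatio β c τ η) :
    ENNReal.ofReal (2 * ((∫ η, (‖η - b‖ ^ (2 * s - d)) ^ 2 * U η ^ 2 * heatRatio s b τ η) -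
        ∫ η, (‖η - b‖ ^ (2 * s - d)) ^ 2 * U η ^ 2 * heatRatio β c τ η)) ≤
      ∫⁻ η, ∫⁻ ζ, ENNReal.ofReal (heat τ (η - ζ) *
        (‖η - b‖ ^ (2 * s - d) * ‖ζ - b‖ ^ (2 * s - d) * (U η - U ζ) ^ 2)) := by
  have key := lintegral_heatRatio_le hd hs0 hs hβ0 hβ hτ b c hU
  have hb0 : ∀ η, 0 ≤ (‖η - b‖ ^ (2 * s - d)) ^ 2 * U η ^ 2 * heatRatio s b τ η := fun η ↦ by
    have := heatRatio_nonneg hs hτ b η; positivity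
  have hc0 : ∀ η, 0 ≤ (‖η - b‖ ^ (2 * s - d)) ^ 2 * U η ^ 2 * heatRatio β c τ η := fun η ↦ by
    have := heatRatio_nonneg hβ hτ c η; positivity
  rw [← ofReal_integral_eq_lintegral_ofReal hib (ae_of_all _ hb0),
    ← ofReal_integral_eq_lintegral_ofReal hic (ae_of_all _ hc0)] at key
  have h2 : (2 : ENNReal) = ENNReal.ofReal 2 := by simp
  rw [mul_sub, ENNReal.ofReal_sub _ (mul_nonneg zero_le_two (integral_nonneg hc0)),
    ENNReal.ofReal_mul zero_le_two, ENNReal.ofReal_mul zero_le_two, ← h2]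
  exact tsub_le_iff_right.mpr key

lemma fractional_hardy_const {s : ℝ} (hs0 : 0 < s) (hs1 : s < 1) (hds : 2 * s < d) :
    a_sd d s * (Gamma (1 - s) * Gamma (((d:ℝ) + 2 * s) / 4) /
        (s * Gamma (((d:ℝ) + 2 * s) / 4 - s)) *
        (Gamma ((d:ℝ) / 2 - ((d:ℝ) + 2 * s) / 4 + s) /
          Gamma ((d:ℝ) / 2 - ((d:ℝ) + 2 * s) / 4))) * 2 =
      C_fH d s * (π ^ (-(d:ℝ) / 2) * Gamma ((d:ℝ) / 2 + s)) := by
  have h1 : (d:ℝ) / 2 - ((d:ℝ) + 2 * s) / 4 + s = ((d:ℝ) + 2 * s) / 4 := by ring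
  have h2 : (d:ℝ) / 2 - ((d:ℝ) + 2 * s) / 4 = ((d:ℝ) - 2 * s) / 4 := by ring
  have h3 : ((d:ℝ) + 2 * s) / 4 - s = ((d:ℝ) - 2 * s) / 4 := by ring
  have h4 : (d:ℝ) / 2 + s = ((d:ℝ) + 2 * s) / 2 := by ring
  have h5 : (2:ℝ) ^ (2 * s) = 2 ^ (2 * s - 1) * 2 := by
    rw [← rpow_add_one two_ne_zero]; congr 1; ring
  have g1 : Gamma (1 - s) ≠ 0 := (Gamma_pos_of_pos (by linarith)).ne'
  have g2 : Gamma (((d:ℝ) - 2 * s) / 4) ≠ 0 := (Gamma_pos_of_pos (by linarith)).ne'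
  rw [h1, h2, h3, h4, a_sd, C_fH, h5]
  generalize Gamma (1 - s) = G1 at g1
  generalize Gamma (((d:ℝ) - 2 * s) / 4) = G2 at g2
  field_simp

lemma a_sd_nonneg {s : ℝ} (hs0 : 0 < s) (hs1 : s < 1) : 0 ≤ a_sd d s := by
  have h1 := Gamma_pos_of_pos (show 0 < 1 - s by linarith)
  have h2 := Gamma_pos_of_pos (show 0 < ((d:ℝ) + 2 * s) / 2 by positivity)
  unfold a_sd
  positivity

lemma C_fH_nonneg (s : ℝ) : 0 ≤ C_fH d s := by
  unfold C_fH
  positivity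

/-- A conformally weighted form of the fractional Hardy inequality. -/
lemma weighted_fractional_hardy {s : ℝ} (hs0 : 0 < s) (hs1 : s < 1) (hds : 2 * s < d)
    (b c : Euc d) {U : Euc d → ℝ} (hU : Measurable U)
    (hi : Integrable fun η ↦ (‖η - b‖ ^ (2 * s - d)) ^ 2 * U η ^ 2)
    (hib : Integrable fun η ↦ (‖η - b‖ ^ (2 * s - d)) ^ 2 * U η ^ 2 * ‖η - b‖ ^ (-(2 * s)))
    (hic : Integrable fun η ↦ (‖η - b‖ ^ (2 * s - d)) ^ 2 * U η ^ 2 * ‖η - c‖ ^ (-(2 * s))) :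
    ENNReal.ofReal (C_fH d s) * (∫⁻ η, ENNReal.ofReal
        ((‖η - b‖ ^ (2 * s - d)) ^ 2 * U η ^ 2 * ‖η - c‖ ^ (-(2 * s)))) ≤
      ENNReal.ofReal (a_sd d s) * ∫⁻ η, ∫⁻ ζ, ENNReal.ofReal
        (‖η - b‖ ^ (2 * s - d) * ‖ζ - b‖ ^ (2 * s - d) * (U η - U ζ) ^ 2 /
          ‖η - ζ‖ ^ ((d:ℝ) + 2 * s)) := by
  have hd : 0 < d := by
    have : (0:ℝ) < d := by linarith
    exact_mod_cast this
  set β := ((d:ℝ) + 2 * s) / 4 with hβdef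
  have hs : s < (d:ℝ) / 2 := by linarith
  have hβ : β < (d:ℝ) / 2 := by rw [hβdef]; linarith
  have hsβ : s ≤ β := by rw [hβdef]; linarith
  have hβ0 : 0 < β := hs0.trans_le hsβ
  set ρ : Euc d → ℝ := fun η ↦ (‖η - b‖ ^ (2 * s - d)) ^ 2 * U η ^ 2 with hρ
  have hρm : Measurable ρ := by fun_prop
  have hρ0 : ∀ η, 0 ≤ ρ η := fun η ↦ by positivity
  obtain ⟨hBi, hBv⟩ := integrable_mul_one_sub_heatRatio hs0 hs1 le_rfl hs hd b hρm hρ0 hib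
  obtain ⟨hCi, hCv⟩ := integrable_mul_one_sub_heatRatio hs0 hs1 hsβ hβ hd c hρm hρ0 hic
  set κ := Gamma (1 - s) * Gamma β / (s * Gamma (β - s)) *
        (Gamma ((d:ℝ) / 2 - β + s) / Gamma ((d:ℝ) / 2 - β)) with hκ
  simp only [sub_self, Gamma_zero, mul_zero, div_zero, zero_mul] at hBv
  set E := ∫⁻ η, ∫⁻ ζ, ENNReal.ofReal
        (‖η - b‖ ^ (2 * s - d) * ‖ζ - b‖ ^ (2 * s - d) * (U η - U ζ) ^ 2 /
          ‖η - ζ‖ ^ ((d:ℝ) + 2 * s)) with hE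
  set J := ∫ η, ρ η * ‖η - c‖ ^ (-(2 * s)) with hJ
  have hpos : ∀ᵐ τ ∂(volume.restrict (Set.Ioi (0:ℝ))), 0 < τ := ae_restrict_mem measurableSet_Ioi
  have hsub : ∀ (β' : ℝ) (e : Euc d) (τ : ℝ), 0 < τ →
      Integrable (fun η ↦ ρ η * (τ ^ (-1 - s) * (1 - heatRatio β' e τ η))) →
      Integrable (fun η ↦ ρ η * heatRatio β' e τ η) ∧
      ∫ η, ρ η * (τ ^ (-1 - s) * (1 - heatRatio β' e τ η)) =
        τ ^ (-1 - s) * ((∫ η, ρ η) - ∫ η, ρ η * heatRatio β' e τ η) := fun β' e τ hτ h ↦ by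
    have hne : τ ^ (-1 - s) ≠ 0 := (rpow_pos_of_pos hτ _).ne'
    have h1 : Integrable fun η ↦ ρ η * heatRatio β' e τ η := by
      refine (hi.sub (h.const_mul (τ ^ (-1 - s))⁻¹)).congr (ae_of_all _ fun η ↦ ?_)
      simp only [Pi.sub_apply, hρ]
      field_simp
      ring
    refine ⟨h1, ?_⟩
    rw [← integral_sub hi h1, ← integral_const_mul]
    exact integral_congr_ae (ae_of_all _ fun η ↦ by ring)
  have hstep : ∀ᵐ τ ∂(volume.restrict (Set.Ioi (0:ℝ))),
      ENNReal.ofReal (2 * ((∫ η, ρ η * (τ ^ (-1 - s) * (1 - heatRatio β c τ η))) -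
        ∫ η, ρ η * (τ ^ (-1 - s) * (1 - heatRatio s b τ η)))) ≤
      ENNReal.ofReal (τ ^ (-1 - s)) * ∫⁻ η, ∫⁻ ζ, ENNReal.ofReal (heat τ (η - ζ) *
        (‖η - b‖ ^ (2 * s - d) * ‖ζ - b‖ ^ (2 * s - d) * (U η - U ζ) ^ 2)) := by
    filter_upwards [hpos, hBi.prod_right_ae, hCi.prod_right_ae] with τ hτ hb hc
    obtain ⟨hb1, hb2⟩ := hsub s b τ hτ hb
    obtain ⟨hc1, hc2⟩ := hsub β c τ hτ hc
    have key := ofReal_integral_heatRatio_sub_le hd hs0 hs hβ0 hβ hτ b c hU hb1 hc1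
    rw [hb2, hc2]
    calc _ = ENNReal.ofReal (τ ^ (-1 - s) * (2 * ((∫ η, ρ η * heatRatio s b τ η) -
            ∫ η, ρ η * heatRatio β c τ η))) := by congr 1; ring
      _ ≤ _ := by
        rw [ENNReal.ofReal_mul (by positivity)]
        gcongr
  have hmain : ENNReal.ofReal (2 * (κ * J)) ≤
      ENNReal.ofReal (π ^ (-(d:ℝ) / 2) * Gamma ((d:ℝ) / 2 + s)) * E := by
    rw [hE, ← lintegral_heat_energy hd hs0 (W := fun η ζ ↦
      ‖η - b‖ ^ (2 * s - d) * ‖ζ - b‖ ^ (2 * s - d) * (U η - U ζ) ^ 2)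
      (by simp only [Function.uncurry_def]; fun_prop)]
    refine le_trans ?_ (lintegral_mono_ae hstep)
    have hii := ((hCi.integral_prod_left.sub hBi.integral_prod_left).const_mul 2)
    refine le_trans (le_of_eq ?_) (ofReal_integral_le_lintegral hii)
    congr 1
    rw [integral_const_mul, integral_sub hCi.integral_prod_left hBi.integral_prod_left, hBv, hCv,
      sub_zero]
  have hic0 : ∀ η, 0 ≤ ρ η * ‖η - c‖ ^ (-(2 * s)) := fun η ↦ mul_nonneg (hρ0 η) (by positivity)
  rw [← ofReal_integral_eq_lintegral_ofReal hic (ae_of_all _ hic0)]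
  have hG := Gamma_pos_of_pos (show 0 < (d:ℝ) / 2 + s by positivity)
  have hP : 0 < π ^ (-(d:ℝ) / 2) * Gamma ((d:ℝ) / 2 + s) := by positivity
  have hconst := fractional_hardy_const hs0 hs1 hds
  rw [← hβdef, ← hκ] at hconst
  refine (ENNReal.mul_le_mul_iff_right (a := ENNReal.ofReal
    (π ^ (-(d:ℝ) / 2) * Gamma ((d:ℝ) / 2 + s))) ?_ ENNReal.ofReal_ne_top).mp ?_
  · simpa using hP
  · calc _ = ENNReal.ofReal (a_sd d s) * ENNReal.ofReal (2 * (κ * J)) := by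
          rw [← ENNReal.ofReal_mul (C_fH_nonneg s), ← ENNReal.ofReal_mul hP.le,
            ← ENNReal.ofReal_mul (a_sd_nonneg hs0 hs1)]
          congr 1
          linear_combination -J * hconst
      _ ≤ ENNReal.ofReal (a_sd d s) *
          (ENNReal.ofReal (π ^ (-(d:ℝ) / 2) * Gamma ((d:ℝ) / 2 + s)) * E) := by gcongr
      _ = _ := by ring

end Heat

section Inversion

open EuclideanGeometry

variable {d : ℕ}

lemma abs_det_fderiv_inversion (b x : Euc d) :
    |((1 / dist x b) ^ 2 • ((ℝ ∙ (x - b))ᗮ.reflection : Euc d →L[ℝ] Euc d)).det| =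
      ‖x - b‖ ^ (-(2 * d : ℝ)) := by
  have h : (((ℝ ∙ (x - b))ᗮ.reflection : Euc d →L[ℝ] Euc d)).det =
      LinearMap.det (ℝ ∙ (x - b))ᗮ.reflection.toLinearMap := rfl
  have h2 : ∀ (r : ℝ) (A : Euc d →L[ℝ] Euc d), (r • A).det = r ^ d * A.det := fun r A ↦ by
    change LinearMap.det (r • (A : Euc d →ₗ[ℝ] Euc d)) = _
    rw [LinearMap.det_smul, finrank_euclideanSpace_fin]
  rw [h2, h, Submodule.det_reflection, abs_mul, abs_pow, abs_pow, abs_pow, abs_neg, abs_one,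
    one_pow, mul_one, dist_eq_norm, abs_of_nonneg (by positivity), one_div, ← pow_mul, inv_pow,
    rpow_neg (norm_nonneg _)]
  norm_cast

/-- Change of variables under the inversion in the unit sphere around `b`. -/
lemma lintegral_inversion (hd : 0 < d) (b : Euc d) (f : Euc d → ENNReal) :
    ∫⁻ y, f y = ∫⁻ η, ENNReal.ofReal (‖η - b‖ ^ (-(2 * d : ℝ))) * f (inversion b 1 η) := by
  have : Nonempty (Fin d) := ⟨⟨0, hd⟩⟩
  have hinv := inversion_involutive b (one_ne_zero (α := ℝ))
  have him : inversion b (1:ℝ) '' {b}ᶜ = {b}ᶜ := by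
    rw [hinv.image_eq_preimage_symm]
    ext x
    simp
  have key := lintegral_image_eq_lintegral_abs_det_fderiv_mul volume
    (measurableSet_singleton b).compl
    (fun x hx ↦ (hasFDerivAt_inversion (R := 1) hx).hasFDerivWithinAt)
    (inversion_injective b one_ne_zero).injOn f
  have hres : (volume : Measure (Euc d)).restrict {b}ᶜ = volume :=
    Measure.restrict_eq_self_of_ae_mem (compl_mem_ae_iff.mpr (measure_singleton b))
  simp_rw [abs_det_fderiv_inversion] at key
  rwa [him, hres] at key

lemma measurable_inversion (b : Euc d) : Measurable (inversion b (1:ℝ)) := by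
  have : inversion b (1:ℝ) = fun x ↦ (1 / dist x b) ^ 2 • (x - b) + b := by
    ext1 x; simp [inversion]
  rw [this]
  fun_prop

lemma lintegral_energy_inversion (hd : 0 < d) {s : ℝ} (b : Euc d) (v : Euc d → ℝ) :
    ∫⁻ y, ∫⁻ z, ENNReal.ofReal ((v y - v z) ^ 2 / ‖y - z‖ ^ ((d:ℝ) + 2 * s)) =
      ∫⁻ η, ∫⁻ ζ, ENNReal.ofReal (‖η - b‖ ^ (2 * s - d) * ‖ζ - b‖ ^ (2 * s - d) *
        (v (inversion b 1 η) - v (inversion b 1 ζ)) ^ 2 / ‖η - ζ‖ ^ ((d:ℝ) + 2 * s)) := by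
  have : Nonempty (Fin d) := ⟨⟨0, hd⟩⟩
  rw [lintegral_inversion hd b]
  have hae : ∀ᵐ η : Euc d, η ≠ b := compl_mem_ae_iff.mpr (measure_singleton b)
  refine lintegral_congr_ae ?_
  filter_upwards [hae] with η hη
  rw [lintegral_inversion hd b, ← lintegral_const_mul' _ _ ENNReal.ofReal_ne_top]
  refine lintegral_congr_ae ?_
  filter_upwards [hae] with ζ hζ
  have hp : 0 < ‖η - b‖ := norm_pos_iff.mpr (sub_ne_zero.mpr hη)
  have hq : 0 < ‖ζ - b‖ := norm_pos_iff.mpr (sub_ne_zero.mpr hζ)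
  have hdist := dist_inversion_inversion hη hζ (1:ℝ)
  simp only [dist_eq_norm] at hdist
  rw [← ENNReal.ofReal_mul (by positivity), ← ENNReal.ofReal_mul (by positivity), hdist]
  generalize ‖η - b‖ = p at *
  generalize ‖ζ - b‖ = q at *
  have hr : 0 ≤ ‖η - ζ‖ := norm_nonneg _
  generalize ‖η - ζ‖ = r at *
  have h1 : ∀ x : ℝ, 0 < x → x ^ (2 * s - d) = x ^ (-(2 * d : ℝ)) * x ^ ((d:ℝ) + 2 * s) :=
    fun x hx ↦ by rw [← rpow_add hx]; congr 1; ring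
  rw [mul_rpow (by positivity) hr, div_rpow (by positivity) (by positivity),
    mul_rpow hp.le hq.le, one_pow, one_rpow, h1 p hp, h1 q hq]
  have := rpow_pos_of_pos hp ((d:ℝ) + 2 * s)
  have := rpow_pos_of_pos hq ((d:ℝ) + 2 * s)
  congr 1
  field_simp

lemma lintegral_potential_inversion (hd : 0 < d) {s : ℝ} {a b : Euc d} (hab : a ≠ b)
    (v : Euc d → ℝ) :
    ∫⁻ y, ENNReal.ofReal (‖a - b‖ ^ (2 * s) / (‖y - a‖ ^ (2 * s) * ‖y - b‖ ^ (2 * s)) *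
        v y ^ 2) =
      ∫⁻ η, ENNReal.ofReal ((‖η - b‖ ^ (2 * s - d)) ^ 2 * v (inversion b 1 η) ^ 2 *
        ‖η - inversion b 1 a‖ ^ (-(2 * s))) := by
  have : Nonempty (Fin d) := ⟨⟨0, hd⟩⟩
  rw [lintegral_inversion hd b]
  refine lintegral_congr_ae ?_
  filter_upwards [compl_mem_ae_iff.mpr (measure_singleton b)] with η hη
  replace hη : η ≠ b := hη
  have hcb : inversion b 1 a ≠ b := by simpa [inversion_eq_center] using hab
  have hp : 0 < ‖η - b‖ := norm_pos_iff.mpr (sub_ne_zero.mpr hη)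
  have hk : 0 < ‖inversion b 1 a - b‖ := norm_pos_iff.mpr (sub_ne_zero.mpr hcb)
  have h1 := dist_inversion_inversion hη hcb (1:ℝ)
  have h2 := dist_inversion_center b η (1:ℝ)
  have h3 := dist_inversion_center b (inversion b 1 a) (1:ℝ)
  rw [inversion_inversion _ one_ne_zero] at h1 h3
  simp only [dist_eq_norm] at h1 h2 h3
  rw [← ENNReal.ofReal_mul (by positivity), h1, h2, h3]
  generalize ‖η - b‖ = p at *
  generalize ‖inversion b 1 a - b‖ = k at *
  have hr : 0 ≤ ‖η - inversion b 1 a‖ := norm_nonneg _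
  generalize ‖η - inversion b 1 a‖ = r at *
  have h4 : (p ^ (2 * s - d)) ^ 2 = p ^ (-(2 * d : ℝ)) * p ^ (2 * s) * p ^ (2 * s) := by
    rw [← rpow_add hp, ← rpow_add hp, ← rpow_natCast, ← rpow_mul hp.le]
    congr 1; push_cast; ring
  rw [mul_rpow (by positivity) hr, div_rpow (by positivity) (by positivity),
    div_rpow (by positivity) (by positivity), div_rpow (by positivity) (by positivity),
    mul_rpow hp.le hk.le, one_pow, one_rpow, h4, rpow_neg hr]
  have := rpow_pos_of_pos hp (2 * s)
  have := rpow_pos_of_pos hk (2 * s)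
  congr 1
  generalize r ^ (2 * s) = R
  field_simp

lemma integrable_of_continuousOn_of_support_subset {f : Euc d → ℝ} {K : Set (Euc d)}
    (hK : IsCompact K) (hf : ContinuousOn f K) (hfK : Function.support f ⊆ K) :
    Integrable f :=
  (integrableOn_iff_integrable_of_support_subset hfK).mp (hf.integrableOn_compact hK)

/-- The fractional Hardy inequality with two poles `a` and `b`. -/
lemma two_pole_fractional_hardy {s : ℝ} (hs0 : 0 < s) (hs1 : s < 1) (hds : 2 * s < d)
    {a b : Euc d} (hab : a ≠ b) {v : Euc d → ℝ} (hv : Continuous v)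
    (hvs : HasCompactSupport v) (ha : a ∉ tsupport v) (hb : b ∉ tsupport v) :
    ENNReal.ofReal (C_fH d s) * (∫⁻ y, ENNReal.ofReal
        (‖a - b‖ ^ (2 * s) / (‖y - a‖ ^ (2 * s) * ‖y - b‖ ^ (2 * s)) * v y ^ 2)) ≤
      ENNReal.ofReal (a_sd d s) * ∫⁻ y, ∫⁻ z, ENNReal.ofReal
        ((v y - v z) ^ 2 / ‖y - z‖ ^ ((d:ℝ) + 2 * s)) := by
  have hd : 0 < d := by
    have : (0:ℝ) < d := by linarith
    exact_mod_cast this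
  rw [lintegral_potential_inversion hd hab, lintegral_energy_inversion hd b]
  set U : Euc d → ℝ := fun η ↦ v (inversion b 1 η) with hU
  set c := inversion b 1 a with hc
  have hUm : Measurable U := hv.measurable.comp (measurable_inversion b)
  set K : Set (Euc d) := inversion b 1 '' tsupport v with hKdef
  have hinv : ∀ x, inversion b (1:ℝ) (inversion b 1 x) = x :=
    inversion_inversion b one_ne_zero
  have hιc : ContinuousOn (inversion b (1:ℝ)) {b}ᶜ :=
    continuousOn_const.inversion continuousOn_const continuousOn_id fun x hx ↦ hx
  have hK : IsCompact K := by
    refine IsCompact.image_of_continuousOn hvs (hιc.mono fun x hx h ↦ hb ?_)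
    rwa [← Set.mem_singleton_iff.mp h]
  have hbK : ∀ η ∈ K, η ≠ b := by
    rintro _ ⟨y, hy, rfl⟩ h
    rw [inversion_eq_center one_ne_zero] at h
    exact hb (h ▸ hy)
  have hcK : ∀ η ∈ K, η ≠ c := by
    rintro _ ⟨y, hy, rfl⟩ h
    exact ha (inversion_injective b one_ne_zero h ▸ hy)
  have hUK : Function.support U ⊆ K := fun η hη ↦
    ⟨inversion b 1 η, subset_tsupport v hη, hinv η⟩
  have hUc : ContinuousOn U K := hv.comp_continuousOn (hιc.mono hbK)
  have hpow : ∀ (e : Euc d) (p : ℝ), (∀ η ∈ K, η ≠ e) →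
      ContinuousOn (fun η ↦ ‖η - e‖ ^ p) K := fun e p he ↦
    ContinuousOn.rpow_const (by fun_prop) fun η hη ↦
      Or.inl (norm_ne_zero_iff.mpr (sub_ne_zero.mpr (he η hη)))
  have hρ : ContinuousOn (fun η ↦ (‖η - b‖ ^ (2 * s - d)) ^ 2 * U η ^ 2) K :=
    ((hpow b _ hbK).pow 2).mul (hUc.pow 2)
  have hsup : ∀ w : Euc d → ℝ,
      Function.support (fun η ↦ (‖η - b‖ ^ (2 * s - d)) ^ 2 * U η ^ 2 * w η) ⊆ K :=
    fun w η hη ↦ hUK fun h ↦ hη (by simp [h])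
  exact weighted_fractional_hardy hs0 hs1 hds b c hUm
    (integrable_of_continuousOn_of_support_subset hK hρ (by simpa using hsup fun _ ↦ 1))
    (integrable_of_continuousOn_of_support_subset hK (hρ.mul (hpow b _ hbK)) (hsup _))
    (integrable_of_continuousOn_of_support_subset hK (hρ.mul (hpow c _ hcK)) (hsup _))

end Inversion

section Particles

variable {d n : ℕ}

lemma lintegral_insertNth (i : Fin (n + 1)) {F : (Fin (n + 1) → Euc d) → ENNReal}
    (hF : Measurable F) :
    ∫⁻ x, F x = ∫⁻ r : Fin n → Euc d, ∫⁻ y : Euc d,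
      F (i.insertNth (α := fun _ ↦ Euc d) y r) := by
  have hp := (volume_preserving_piFinSuccAbove (fun _ : Fin (n + 1) ↦ Euc d) i).symm
  rw [← hp.lintegral_comp_emb (MeasurableEquiv.measurableEmbedding _) F]
  exact lintegral_prod_symm _ (hF.comp (MeasurableEquiv.measurable _)).aemeasurable

lemma measurable_insertNth (i : Fin (n + 1)) :
    Measurable fun p : Euc d × (Fin n → Euc d) ↦
      (i.insertNth (α := fun _ ↦ Euc d) p.1 p.2 : Fin (n + 1) → Euc d) :=
  (Continuous.finInsertNth (A := fun _ ↦ Euc d) i continuous_fst continuous_snd).measurable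

lemma integrable_min_one_sq_div_rpow (hd : 0 < d) {s : ℝ} (hs0 : 0 < s) (hs1 : s < 1) :
    Integrable fun z : Euc d ↦ min 1 (‖z‖ ^ 2) / ‖z‖ ^ ((d:ℝ) + 2 * s) := by
  have : Nonempty (Fin d) := ⟨⟨0, hd⟩⟩
  rw [integrable_fun_norm_addHaar (μ := (volume : Measure (Euc d)))
    (f := fun r : ℝ ↦ min 1 (r ^ 2) / r ^ ((d:ℝ) + 2 * s)), finrank_euclideanSpace_fin,
    ← Set.Ioc_union_Ioi_eq_Ioi zero_le_one]
  have hpow : ∀ r : ℝ, 0 < r → r ^ (d - 1) = r ^ ((d:ℝ) + 2 * s) * r ^ (-1 - 2 * s) :=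
    fun r hr ↦ by
      rw [← rpow_add hr, ← rpow_natCast, Nat.cast_sub hd]
      congr 1; push_cast; ring
  refine IntegrableOn.union ?_ ?_
  · refine IntegrableOn.congr_fun (f := fun r : ℝ ↦ r ^ (1 - 2 * s)) ?_ ?_ measurableSet_Ioc
    · rw [integrableOn_Ioc_iff_integrableOn_Ioo,
        intervalIntegral.integrableOn_Ioo_rpow_iff zero_lt_one]
      linarith
    · rintro r ⟨hr0, hr1⟩
      have := rpow_pos_of_pos hr0 ((d:ℝ) + 2 * s)
      have h2 : r ^ (1 - 2 * s) = r ^ (-1 - 2 * s) * r ^ 2 := by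
        rw [← rpow_natCast, ← rpow_add hr0]; congr 1; push_cast; ring
      simp only [smul_eq_mul]
      rw [min_eq_right (pow_le_one₀ hr0.le hr1), hpow r hr0, h2]
      field_simp
  · refine IntegrableOn.congr_fun (f := fun r : ℝ ↦ r ^ (-1 - 2 * s)) ?_ ?_ measurableSet_Ioi
    · exact integrableOn_Ioi_rpow_of_lt (by linarith) zero_lt_one
    · intro r hr
      have hr1 : 1 < r := hr
      have hr0 : 0 < r := zero_lt_one.trans hr1
      have := rpow_pos_of_pos hr0 ((d:ℝ) + 2 * s)
      simp only [smul_eq_mul]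
      rw [min_eq_left (one_le_pow₀ hr1.le), hpow r hr0]
      field_simp

/-- Tonelli's theorem for a translation-invariant kernel acting on the `i`-th particle, together
with the symmetric term. -/
lemma lintegral_update_kernel (i : Fin (n + 1)) {k : Euc d → ENNReal} (hk : Measurable k)
    (hsymm : ∀ z, k (-z) = k z) {φ : (Fin (n + 1) → Euc d) → ENNReal} (hφ : Measurable φ) :
    ∫⁻ x, ∫⁻ z, k (x i - z) * (φ x + φ (Function.update x i z)) =
      2 * ((∫⁻ z, k z) * ∫⁻ x, φ x) := by
  have hup : Measurable fun p : (Fin (n + 1) → Euc d) × Euc d ↦ Function.update p.1 i p.2 :=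
    measurable_update'
  have hki : Measurable fun p : (Fin (n + 1) → Euc d) × Euc d ↦ k (p.1 i - p.2) := by
    fun_prop
  have hm1 : Measurable fun x : Fin (n + 1) → Euc d ↦ ∫⁻ z, k (x i - z) * φ x :=
    (hki.mul (hφ.comp measurable_fst)).lintegral_prod_right'
  have hm2 : Measurable fun x : Fin (n + 1) → Euc d ↦
      ∫⁻ z, k (x i - z) * φ (Function.update x i z) :=
    (hki.mul (hφ.comp hup)).lintegral_prod_right'
  have h1 : ∫⁻ x, ∫⁻ z, k (x i - z) * φ x = (∫⁻ z, k z) * ∫⁻ x, φ x := by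
    rw [← lintegral_const_mul _ hφ]
    refine lintegral_congr fun x ↦ ?_
    rw [lintegral_mul_const _ (by fun_prop), lintegral_sub_left_eq_self]
  have h2 : ∫⁻ x, ∫⁻ z, k (x i - z) * φ (Function.update x i z) =
      (∫⁻ z, k z) * ∫⁻ x, φ x := by
    rw [← h1, lintegral_insertNth i hm2, lintegral_insertNth i hm1]
    refine lintegral_congr fun r ↦ ?_
    simp only [Fin.update_insertNth, Fin.insertNth_apply_same]
    have hm : Measurable fun y : Euc d ↦ φ (i.insertNth (α := fun _ ↦ Euc d) y r) :=
      hφ.comp ((measurable_insertNth i).comp (by fun_prop : Measurable fun y : Euc d ↦ (y, r)))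
    rw [lintegral_lintegral_swap (f := fun y z : Euc d ↦
      k (y - z) * φ (i.insertNth (α := fun _ ↦ Euc d) z r)) (by fun_prop)]
    refine lintegral_congr fun y ↦ lintegral_congr fun z ↦ ?_
    rw [← hsymm, neg_sub]
  rw [two_mul]
  nth_rw 1 [← h1]
  rw [← h2, ← lintegral_add_left hm1]
  refine lintegral_congr fun x ↦ ?_
  simp_rw [mul_add]
  exact lintegral_add_left (by fun_prop) _

lemma exists_sq_sub_update_le (i : Fin (n + 1)) {u : (Fin (n + 1) → Euc d) → ℝ}
    (hu : ContDiff ℝ (⊤ : ℕ∞) u) (hus : HasCompactSupport u) :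
    ∃ M : ℝ, 0 ≤ M ∧ ∀ x z, (u x - u (Function.update x i z)) ^ 2 ≤
      M * min 1 (‖x i - z‖ ^ 2) := by
  obtain ⟨B, hB⟩ := hus.exists_bound_of_continuous hu.continuous
  obtain ⟨L, hL⟩ := ContDiff.lipschitzWith_of_hasCompactSupport hus hu (by simp)
  refine ⟨(2 * B) ^ 2 + L ^ 2, by positivity, fun x z ↦ ?_⟩
  have h1 : |u x - u (Function.update x i z)| ≤ 2 * B := by
    have := norm_sub_le (u x) (u (Function.update x i z))
    rw [Real.norm_eq_abs] at this
    linarith [hB x, hB (Function.update x i z)]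
  have h2 : |u x - u (Function.update x i z)| ≤ L * ‖x i - z‖ := by
    have h := hL.dist_le_mul x (Function.update x i z)
    rw [Real.dist_eq] at h
    refine h.trans (mul_le_mul_of_nonneg_left ?_ L.2)
    refine (dist_pi_le_iff (norm_nonneg _)).mpr fun j ↦ ?_
    rcases eq_or_ne j i with rfl | hj
    · simp [dist_eq_norm]
    · simp [hj]
  rw [← sq_abs]
  rcases min_cases 1 (‖x i - z‖ ^ 2) with ⟨h, -⟩ | ⟨h, -⟩ <;> rw [h]
  · nlinarith [abs_nonneg (u x - u (Function.update x i z)), sq_nonneg (L : ℝ)]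
  · have := pow_le_pow_left₀ (abs_nonneg _) h2 2
    nlinarith [mul_nonneg (sq_nonneg (2 * B)) (sq_nonneg ‖x i - z‖)]

lemma integrable_kinetic_density (hd : 0 < d) {s : ℝ} (hs0 : 0 < s) (hs1 : s < 1)
    (i : Fin (n + 1)) {u : (Fin (n + 1) → Euc d) → ℝ}
    (hu : ContDiff ℝ (⊤ : ℕ∞) u) (hus : HasCompactSupport u) :
    Integrable (fun p : (Fin (n + 1) → Euc d) × Euc d ↦
      (u p.1 - u (Function.update p.1 i p.2)) ^ 2 / ‖p.1 i - p.2‖ ^ ((d:ℝ) + 2 * s))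
      (volume.prod volume) := by
  obtain ⟨M, hM0, hM⟩ := exists_sq_sub_update_le i hu hus
  have hum := hu.continuous.measurable
  have hup : Measurable fun p : (Fin (n + 1) → Euc d) × Euc d ↦ u (Function.update p.1 i p.2) :=
    hum.comp measurable_update'
  have hgm : Measurable fun p : (Fin (n + 1) → Euc d) × Euc d ↦
      (u p.1 - u (Function.update p.1 i p.2)) ^ 2 / ‖p.1 i - p.2‖ ^ ((d:ℝ) + 2 * s) := by
    fun_prop
  refine ⟨hgm.aestronglyMeasurable, ?_⟩
  rw [hasFiniteIntegral_iff_ofReal (ae_of_all _ fun p ↦ by positivity),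
    lintegral_prod _ (by fun_prop)]
  set κ : Euc d → ℝ := fun z ↦ min 1 (‖z‖ ^ 2) / ‖z‖ ^ ((d:ℝ) + 2 * s) with hκ
  have hκm : Measurable κ := by fun_prop
  set φ : (Fin (n + 1) → Euc d) → ENNReal := (tsupport u).indicator 1 with hφ
  have hφm : Measurable φ := measurable_one.indicator (isClosed_tsupport u).measurableSet
  have hle : ∀ x z, ENNReal.ofReal ((u x - u (Function.update x i z)) ^ 2 /
      ‖x i - z‖ ^ ((d:ℝ) + 2 * s)) ≤
      ENNReal.ofReal (M * κ (x i - z)) * (φ x + φ (Function.update x i z)) := fun x z ↦ by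
    by_cases hx : u x = 0 ∧ u (Function.update x i z) = 0
    · simp [hx.1, hx.2]
    · have h1 : 1 ≤ φ x + φ (Function.update x i z) := by
        rcases not_and_or.mp hx with h | h
        · exact le_add_right (by simp [hφ, subset_tsupport u h])
        · exact le_add_left (by simp [hφ, subset_tsupport u h])
      refine le_trans (le_trans ?_ (mul_one _).ge) (mul_le_mul_right h1 _)
      refine ENNReal.ofReal_le_ofReal ?_
      rw [hκ, ← mul_div_assoc]
      gcongr
      exact hM x z
  refine lt_of_le_of_lt (lintegral_mono fun x ↦ lintegral_mono fun z ↦ hle x z) ?_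
  rw [lintegral_update_kernel i (k := fun z ↦ ENNReal.ofReal (M * κ z)) (by fun_prop)
    (fun z ↦ by simp [hκ]) hφm]
  refine ENNReal.mul_lt_top (by simp) (ENNReal.mul_lt_top ?_ ?_)
  · exact ((integrable_min_one_sq_div_rpow hd hs0 hs1).const_mul M).lintegral_lt_top
  · rw [hφ, lintegral_indicator_one (isClosed_tsupport u).measurableSet]
    exact hus.isCompact.measure_lt_top

lemma ofReal_integral_kinetic_density (hd : 0 < d) {s : ℝ} (hs0 : 0 < s) (hs1 : s < 1)
    (i : Fin (n + 1)) {u : (Fin (n + 1) → Euc d) → ℝ}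
    (hu : ContDiff ℝ (⊤ : ℕ∞) u) (hus : HasCompactSupport u) :
    ENNReal.ofReal (∫ x : Fin (n + 1) → Euc d, ∫ z : Euc d,
        (u x - u (Function.update x i z)) ^ 2 / ‖x i - z‖ ^ ((d:ℝ) + 2 * s)) =
      ∫⁻ r : Fin n → Euc d, ∫⁻ y : Euc d, ∫⁻ z : Euc d, ENNReal.ofReal
        ((u (i.insertNth (α := fun _ ↦ Euc d) y r) -
          u (i.insertNth (α := fun _ ↦ Euc d) z r)) ^ 2 / ‖y - z‖ ^ ((d:ℝ) + 2 * s)) := by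
  have hint := integrable_kinetic_density hd hs0 hs1 i hu hus
  have hum := hu.continuous.measurable
  have hup : Measurable fun p : (Fin (n + 1) → Euc d) × Euc d ↦ u (Function.update p.1 i p.2) :=
    hum.comp measurable_update'
  have hgm : Measurable fun p : (Fin (n + 1) → Euc d) × Euc d ↦ ENNReal.ofReal
      ((u p.1 - u (Function.update p.1 i p.2)) ^ 2 / ‖p.1 i - p.2‖ ^ ((d:ℝ) + 2 * s)) := by
    fun_prop
  rw [← integral_prod (fun p : (Fin (n + 1) → Euc d) × Euc d ↦
      (u p.1 - u (Function.update p.1 i p.2)) ^ 2 / ‖p.1 i - p.2‖ ^ ((d:ℝ) + 2 * s)) hint,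
    ofReal_integral_eq_lintegral_ofReal hint (ae_of_all _ fun p ↦ by positivity),
    lintegral_prod _ hgm.aemeasurable,
    lintegral_insertNth i hgm.lintegral_prod_right']
  simp only [Fin.update_insertNth, Fin.insertNth_apply_same]

lemma V3_eq_sum (s : ℝ) (x : Fin 3 → Euc d) :
    V3 s (x 0) (x 1) (x 2) = ∑ i : Fin 3, ‖x (i.succAbove 0) - x (i.succAbove 1)‖ ^ (2 * s) /
      (‖x i - x (i.succAbove 0)‖ ^ (2 * s) * ‖x i - x (i.succAbove 1)‖ ^ (2 * s)) := by
  have h0 : (0 : Fin 3).succAbove 0 = 1 ∧ (0 : Fin 3).succAbove 1 = 2 := by decide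
  have h1 : (1 : Fin 3).succAbove 0 = 0 ∧ (1 : Fin 3).succAbove 1 = 2 := by decide
  have h2 : (2 : Fin 3).succAbove 0 = 0 ∧ (2 : Fin 3).succAbove 1 = 1 := by decide
  rw [Fin.sum_univ_three, h0.1, h0.2, h1.1, h1.2, h2.1, h2.2, V3, norm_sub_rev (x 1) (x 0),
    norm_sub_rev (x 2) (x 0), norm_sub_rev (x 2) (x 1),
    mul_comm (‖x 0 - x 2‖ ^ (2 * s)) (‖x 0 - x 1‖ ^ (2 * s)),
    mul_comm (‖x 1 - x 2‖ ^ (2 * s)) (‖x 0 - x 2‖ ^ (2 * s))]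

lemma lintegral_pair_potential_le {s : ℝ} (hs0 : 0 < s) (hs1 : s < 1) (hds : 2 * s < d)
    {u : (Fin 3 → Euc d) → ℝ} (hu : ContDiff ℝ (⊤ : ℕ∞) u) (hus : HasCompactSupport u)
    (hoff : tsupport u ⊆ {x : Fin 3 → Euc d | ∀ i j, i ≠ j → x i ≠ x j}) (i : Fin 3) :
    ENNReal.ofReal (C_fH d s) * (∫⁻ x : Fin 3 → Euc d, ENNReal.ofReal
        (‖x (i.succAbove 0) - x (i.succAbove 1)‖ ^ (2 * s) /
          (‖x i - x (i.succAbove 0)‖ ^ (2 * s) * ‖x i - x (i.succAbove 1)‖ ^ (2 * s)) *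
          u x ^ 2)) ≤
      ENNReal.ofReal (a_sd d s * ∫ x : Fin 3 → Euc d, ∫ z : Euc d,
        (u x - u (Function.update x i z)) ^ 2 / ‖x i - z‖ ^ ((d:ℝ) + 2 * s)) := by
  have hd : 0 < d := by
    have : (0:ℝ) < d := by linarith
    exact_mod_cast this
  have hum := hu.continuous.measurable
  rw [ENNReal.ofReal_mul (a_sd_nonneg hs0 hs1),
    ofReal_integral_kinetic_density hd hs0 hs1 i hu hus, lintegral_insertNth i (by fun_prop),
    ← lintegral_const_mul' _ _ ENNReal.ofReal_ne_top,
    ← lintegral_const_mul' _ _ ENNReal.ofReal_ne_top]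
  refine lintegral_mono fun r ↦ ?_
  simp only [Fin.insertNth_apply_same, Fin.insertNth_apply_succAbove]
  rcases eq_or_ne (r 0) (r 1) with hr | hr
  · simp [hr, zero_rpow (by positivity : 2 * s ≠ 0)]
  set ι : Euc d → Fin 3 → Euc d := fun y ↦ i.insertNth (α := fun _ ↦ Euc d) y r with hι
  have hιc : Continuous ι :=
    Continuous.finInsertNth (A := fun _ ↦ Euc d) i continuous_id continuous_const
  have hsub : tsupport (u ∘ ι) ⊆ ι ⁻¹' tsupport u := tsupport_comp_subset_preimage u hιc
  have hnot : ∀ j, r j ∉ tsupport (u ∘ ι) := fun j hj ↦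
    hoff (hsub hj) i (i.succAbove j) (Fin.succAbove_ne i j).symm (by simp [hι])
  have hcomp : HasCompactSupport (u ∘ ι) :=
    (hus.isCompact.image (continuous_apply i)).of_isClosed_subset (isClosed_tsupport _)
      fun y hy ↦ ⟨ι y, hsub hy, by simp [hι]⟩
  exact two_pole_fractional_hardy hs0 hs1 hds hr (hu.continuous.comp hιc) hcomp (hnot 0) (hnot 1)

end Particles

/-- **Theorem 1.1** (sharp three-particle fractional Hardy inequality). -/
theorem three_particle_fractional_Hardy
    (d : ℕ) (hd : 0 < d) (s : ℝ) (hs : s ∈ Set.Ioo (0:ℝ) 1)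
    (hds : (4:ℝ) - 2*s ≤ (d:ℝ))
    (u : (Fin 3 → Euc d) → ℝ)
    (hu_smooth : ContDiff ℝ (⊤ : ℕ∞) u) (hu_supp : HasCompactSupport u)
    (hu_off : tsupport u ⊆ {x : Fin 3 → Euc d | ∀ i j, i ≠ j → x i ≠ x j}) :
    C_fH d s * ∫ x : Fin 3 → Euc d, V3 s (x 0) (x 1) (x 2) * (u x)^2
      ≤ kinetic d 3 s u := by
  obtain ⟨hs0, hs1⟩ := hs
  have h2s : 2 * s < d := by linarith
  have hum := hu_smooth.continuous.measurable
  have hk : ∀ i : Fin 3, 0 ≤ a_sd d s * ∫ x : Fin 3 → Euc d, ∫ z : Euc d,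
      (u x - u (Function.update x i z)) ^ 2 / ‖x i - z‖ ^ ((d:ℝ) + 2 * s) := fun i ↦
    mul_nonneg (a_sd_nonneg hs0 hs1)
      (integral_nonneg fun x ↦ integral_nonneg fun z ↦ by positivity)
  rw [kinetic, ← ENNReal.ofReal_le_ofReal_iff (Finset.sum_nonneg fun i _ ↦ hk i),
    ENNReal.ofReal_mul (C_fH_nonneg s), ENNReal.ofReal_sum_of_nonneg fun i _ ↦ hk i]
  calc _ ≤ ENNReal.ofReal (C_fH d s) * ∫⁻ x : Fin 3 → Euc d,
        ENNReal.ofReal (V3 s (x 0) (x 1) (x 2) * u x ^ 2) := by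
        gcongr
        by_cases hi : Integrable fun x : Fin 3 → Euc d ↦ V3 s (x 0) (x 1) (x 2) * u x ^ 2
        · exact ofReal_integral_le_lintegral hi
        · simp [integral_undef hi]
    _ = ∑ i : Fin 3, ENNReal.ofReal (C_fH d s) * ∫⁻ x : Fin 3 → Euc d, ENNReal.ofReal
        (‖x (i.succAbove 0) - x (i.succAbove 1)‖ ^ (2 * s) /
          (‖x i - x (i.succAbove 0)‖ ^ (2 * s) * ‖x i - x (i.succAbove 1)‖ ^ (2 * s)) *
          u x ^ 2) := by
        rw [← Finset.mul_sum, ← lintegral_finsetSum _ fun i _ ↦ by fun_prop]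
        congr 1
        refine lintegral_congr fun x ↦ ?_
        rw [V3_eq_sum, Finset.sum_mul, ENNReal.ofReal_sum_of_nonneg fun i _ ↦ by positivity]
    _ ≤ _ := Finset.sum_le_sum fun i _ ↦
        lintegral_pair_potential_le hs0 hs1 h2s hu_smooth hu_supp hu_off i
end
end

section
/- Let d ≥ 2 be an integer, let x, y, z ∈ ℝ^d be pairwise distinct points, and let d₁, d₂, d₃ be real exponents with 0 < d₁, d₂, d₃ < d and d₁ + d₂ + d₃ = 2d. Then the integral ∫_{ℝ^d} ((x−t)·(y−t)) / (|x−t|^{d₂+1}·|y−t|^{d₃+1}·|z−t|^{d₁}) dt converges absolutely and equals C_{MOZ}(d₁,d₂,d₃,d) · (((x−z)·(y−z)) / (|x−z|^{d−d₃+1}·|y−z|^{d−d₂+1}·|x−y|^{d−d₁})), where C_{MOZ}(d₁,d₂,d₃,d) := π^{d/2} · (Γ((d−d₁)/2)/Γ(d₁/2)) · (Γ((d−d₂+1)/2)/Γ((d₂+1)/2)) · (Γ((d−d₃+1)/2)/Γ((d₃+1)/2)). -/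
open MeasureTheory Real
open scoped RealInnerProductSpace

noncomputable section

/-- The constant `C_{MOZ}(d₁,d₂,d₃,d)` of the angular Selberg-type identity. -/
def CMOZ (d₁ d₂ d₃ : ℝ) (d : ℕ) : ℝ :=
  Real.pi ^ ((d:ℝ)/2) * (Real.Gamma (((d:ℝ) - d₁)/2) / Real.Gamma (d₁/2))
    * (Real.Gamma (((d:ℝ) - d₂ + 1)/2) / Real.Gamma ((d₂+1)/2))
    * (Real.Gamma (((d:ℝ) - d₃ + 1)/2) / Real.Gamma ((d₃+1)/2))

/-- Fubini–Tonelli for a nonnegative kernel on a product: integrating out one variable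
preserves integrability, and the order of integration may be exchanged. -/
theorem integrable_and_integral_swap_of_nonneg {X Y : Type*} [MeasurableSpace X]
    [MeasurableSpace Y] {μ : Measure X} {ν : Measure Y} [SFinite μ] [SFinite ν]
    {f : X → Y → ℝ} (hf : AEStronglyMeasurable (Function.uncurry f) (μ.prod ν))
    (h0 : ∀ᵐ a ∂μ, ∀ᵐ b ∂ν, 0 ≤ f a b) (h1 : ∀ᵐ a ∂μ, Integrable (f a) ν)
    (h2 : Integrable (fun a => ∫ b, f a b ∂ν) μ) :
    Integrable (fun b => ∫ a, f a b ∂μ) ν ∧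
      ∫ b, ∫ a, f a b ∂μ ∂ν = ∫ a, ∫ b, f a b ∂ν ∂μ := by
  have hint : Integrable (Function.uncurry f) (μ.prod ν) := by
    refine (integrable_prod_iff hf).2 ⟨h1, h2.congr ?_⟩
    filter_upwards [h0] with a ha
    refine integral_congr_ae ?_
    filter_upwards [ha] with b hb
    simp [Function.uncurry, abs_of_nonneg hb]
  exact ⟨hint.integral_prod_right, (integral_integral_swap hint).symm⟩

theorem integrableOn_rpow_mul_exp_neg_mul {a r : ℝ} (ha : 0 < a) (hr : 0 < r) :
    IntegrableOn (fun t : ℝ => t ^ (a - 1) * exp (-(r * t))) (Set.Ioi 0) := by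
  have := integrableOn_rpow_mul_exp_neg_mul_rpow (p := 1) (s := a - 1) (b := r)
    (by linarith) one_pos hr
  simpa using this

/-- The beta integral over the half-line, in homogeneous form. -/
theorem integrableOn_and_integral_rpow_mul_add_mul_rpow {u v a b : ℝ} (hu : 0 < u) (hv : 0 < v)
    (ha : 0 < a) (hb : 0 < b) :
    IntegrableOn (fun q : ℝ => q ^ (u - 1) * (a + q * b) ^ (-(u + v))) (Set.Ioi 0) ∧
    ∫ q in Set.Ioi (0 : ℝ), q ^ (u - 1) * (a + q * b) ^ (-(u + v))
      = Gamma u * Gamma v / Gamma (u + v) * a ^ (-v) * b ^ (-u) := by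
  have hG : 0 < Gamma (u + v) := Gamma_pos_of_pos (by positivity)
  let f : ℝ → ℝ → ℝ := fun s q =>
    q ^ (u - 1) * (s ^ (u + v - 1) * exp (-((a + q * b) * s)))
  have hf : AEStronglyMeasurable (Function.uncurry f)
      ((volume.restrict (Set.Ioi (0 : ℝ))).prod (volume.restrict (Set.Ioi (0 : ℝ)))) := by
    refine Measurable.aestronglyMeasurable ?_
    simp only [f, Function.uncurry_def]
    fun_prop
  have hsplit : ∀ s q : ℝ, f s q =
      s ^ (u + v - 1) * exp (-(a * s)) * (q ^ (u - 1) * exp (-((s * b) * q))) := by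
    intro s q
    have : -((a + q * b) * s) = -(a * s) + -((s * b) * q) := by ring
    simp only [f]
    rw [this, exp_add]
    ring
  have hinner : ∀ s ∈ Set.Ioi (0 : ℝ), ∫ q in Set.Ioi (0 : ℝ), f s q =
      Gamma u * b ^ (-u) * (s ^ (v - 1) * exp (-(a * s))) := by
    intro s hs
    have hs : 0 < s := hs
    simp_rw [hsplit]
    rw [integral_const_mul, integral_rpow_mul_exp_neg_mul_Ioi hu (by positivity), one_div,
      inv_rpow (by positivity), ← rpow_neg (by positivity), mul_rpow hs.le hb.le,
      show u + v - 1 = (v - 1) + u by ring, rpow_add hs, rpow_neg hs.le]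
    field_simp
  have houter : ∀ q ∈ Set.Ioi (0 : ℝ), ∫ s in Set.Ioi (0 : ℝ), f s q =
      Gamma (u + v) * (q ^ (u - 1) * (a + q * b) ^ (-(u + v))) := by
    intro q hq
    have hq : 0 < q := hq
    simp only [f]
    rw [integral_const_mul, integral_rpow_mul_exp_neg_mul_Ioi (by positivity) (by positivity),
      one_div, inv_rpow (by positivity), ← rpow_neg (by positivity)]
    ring
  have key := integrable_and_integral_swap_of_nonneg hf
    (by
      filter_upwards [ae_restrict_mem measurableSet_Ioi] with s hs
      filter_upwards [ae_restrict_mem measurableSet_Ioi] with q hq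
      have hs : 0 < s := hs
      have hq : 0 < q := hq
      positivity)
    (by
      filter_upwards [ae_restrict_mem measurableSet_Ioi] with s hs
      have hs : 0 < s := hs
      rw [show f s = _ from funext (hsplit s)]
      exact (integrableOn_rpow_mul_exp_neg_mul hu (by positivity)).const_mul _)
    (by
      refine Integrable.congr
        ((integrableOn_rpow_mul_exp_neg_mul hv ha).const_mul (Gamma u * b ^ (-u))) ?_
      filter_upwards [ae_restrict_mem measurableSet_Ioi] with s hs
      exact (hinner s hs).symm)
  have houter' := setIntegral_congr_fun (μ := volume) measurableSet_Ioi houter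
  have hinner' := setIntegral_congr_fun (μ := volume) measurableSet_Ioi hinner
  have hI : IntegrableOn (fun q : ℝ => Gamma (u + v) * (q ^ (u - 1) * (a + q * b) ^ (-(u + v))))
      (Set.Ioi 0) := IntegrableOn.congr_fun key.1 houter measurableSet_Ioi
  refine ⟨?_, ?_⟩
  · refine (hI.const_mul (Gamma (u + v))⁻¹).congr ?_
    filter_upwards with q
    field_simp
  · have h := key.2
    rw [houter', hinner', integral_const_mul, integral_const_mul,
      integral_rpow_mul_exp_neg_mul_Ioi hv ha, one_div, inv_rpow ha.le, ← rpow_neg ha.le] at h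
    field_simp
    linear_combination h

/-- The moments of a radial power kernel on Euclidean space. -/
theorem integrable_and_integral_norm_pow_mul_add_norm_sq_rpow {d : ℕ} (hd : 0 < d) (k : ℕ)
    {a c N : ℝ} (ha : 0 < a) (hc : 0 < c) (hN : ((d : ℝ) + k) / 2 < N) :
    Integrable (fun w : Euc d => ‖w‖ ^ k * (c + ‖w‖ ^ 2 * a) ^ (-N)) ∧
    ∫ w : Euc d, ‖w‖ ^ k * (c + ‖w‖ ^ 2 * a) ^ (-N) =
      π ^ ((d : ℝ) / 2) / Gamma ((d : ℝ) / 2) *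
        (Gamma (((d : ℝ) + k) / 2) * Gamma (N - ((d : ℝ) + k) / 2) / Gamma N) *
        c ^ (((d : ℝ) + k) / 2 - N) * a ^ (-(((d : ℝ) + k) / 2)) := by
  have : Nonempty (Fin d) := ⟨⟨0, hd⟩⟩
  have hd' : (0 : ℝ) < d := by exact_mod_cast hd
  have hu : 0 < ((d : ℝ) + k) / 2 := by positivity
  obtain ⟨hint, hval⟩ := integrableOn_and_integral_rpow_mul_add_mul_rpow hu
    (sub_pos.2 hN) hc ha
  simp only [add_sub_cancel] at hint hval
  rw [← integrableOn_Ioi_comp_rpow_iff _ (two_ne_zero)] at hint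
  rw [← integral_comp_rpow_Ioi_of_pos two_pos] at hval
  have hpt : ∀ r ∈ Set.Ioi (0 : ℝ),
      r ^ (d - 1) • (r ^ k * (c + r ^ 2 * a) ^ (-N)) =
      2⁻¹ * ((2 * r ^ ((2 : ℝ) - 1)) • ((r ^ (2 : ℝ)) ^ (((d : ℝ) + k) / 2 - 1) *
        (c + r ^ (2 : ℝ) * a) ^ (-N))) := by
    intro r hr
    have hr : 0 < r := hr
    have h1 : r ^ (d - 1) * r ^ k = r ^ ((2 : ℝ) - 1) * (r ^ (2 : ℝ)) ^ (((d : ℝ) + k) / 2 - 1) := by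
      rw [← rpow_mul hr.le, ← rpow_add hr, ← pow_add, ← rpow_natCast]
      congr 1
      push_cast [Nat.cast_sub hd]
      ring
    simp only [smul_eq_mul]
    rw [← mul_assoc, h1, rpow_two]
    ring
  refine ⟨?_, ?_⟩
  · rw [integrable_fun_norm_addHaar volume (f := fun r : ℝ => r ^ k * (c + r ^ 2 * a) ^ (-N)),
      finrank_euclideanSpace_fin]
    refine IntegrableOn.congr_fun (hint.const_mul 2⁻¹) (fun r hr => ?_) measurableSet_Ioi
    rw [hpt r hr]
    simp
  · rw [integral_fun_norm_addHaar volume (fun r : ℝ => r ^ k * (c + r ^ 2 * a) ^ (-N)),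
      finrank_euclideanSpace_fin, setIntegral_congr_fun measurableSet_Ioi hpt,
      integral_const_mul, hval, Measure.real, EuclideanSpace.volume_ball]
    have hG : 0 < Gamma ((d : ℝ) / 2) := Gamma_pos_of_pos (by positivity)
    have hpi : √π ^ d = π ^ ((d : ℝ) / 2) := by
      rw [sqrt_eq_rpow, ← rpow_natCast, ← rpow_mul pi_pos.le]
      congr 1
      ring
    have hG' : Gamma ((d : ℝ) / 2 + 1) = (d : ℝ) / 2 * Gamma ((d : ℝ) / 2) :=
      Gamma_add_one (by positivity)
    simp only [Fintype.card_fin, ENNReal.ofReal_one, one_pow, one_mul]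
    rw [ENNReal.toReal_ofReal (by rw [hG']; positivity), hpi, hG', neg_sub]
    simp only [nsmul_eq_mul, smul_eq_mul]
    field_simp

theorem norm_sq_add_mul_norm_sub_sq {d : ℕ} {q : ℝ} (hq : 0 < q) (v w : Euc d) :
    ‖w + (q / (1 + q)) • v‖ ^ 2 + q * ‖w + (q / (1 + q)) • v - v‖ ^ 2 =
      q / (1 + q) * ‖v‖ ^ 2 + ‖w‖ ^ 2 * (1 + q) := by
  have h : (1 + q) ≠ 0 := by positivity
  simp only [← real_inner_self_eq_norm_sq, inner_add_left, inner_add_right, inner_sub_left,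
    inner_sub_right, real_inner_smul_left, real_inner_smul_right, real_inner_comm w v]
  field_simp
  ring

theorem inner_self_sub_add_smul {d : ℕ} {q : ℝ} (hq : 0 < q) (v w : Euc d) :
    ⟪w + (q / (1 + q)) • v, w + (q / (1 + q)) • v - v⟫ =
      ‖w‖ ^ 2 + (q - 1) / (1 + q) * ⟪w, v⟫ - q / (1 + q) * ‖v‖ ^ 2 * (1 + q)⁻¹ := by
  have h : (1 + q) ≠ 0 := by positivity
  simp only [← real_inner_self_eq_norm_sq, inner_add_left, inner_add_right,
    inner_sub_right, real_inner_smul_left, real_inner_smul_right, real_inner_comm w v]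
  field_simp
  ring

theorem integrable_and_integral_add_mul_norm_rpow {d : ℕ} (hd : 0 < d) {q N : ℝ} (hq : 0 < q)
    (hN : (d : ℝ) / 2 < N) {v : Euc d} (hv : v ≠ 0) :
    Integrable (fun u : Euc d => (‖u‖ ^ 2 + q * ‖u - v‖ ^ 2) ^ (-N)) ∧
    ∫ u : Euc d, (‖u‖ ^ 2 + q * ‖u - v‖ ^ 2) ^ (-N) =
      π ^ ((d : ℝ) / 2) * (Gamma (N - (d : ℝ) / 2) / Gamma N) *
        (q / (1 + q) * ‖v‖ ^ 2) ^ ((d : ℝ) / 2 - N) * (1 + q) ^ (-((d : ℝ) / 2)) := by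
  have hd' : (0 : ℝ) < d := by exact_mod_cast hd
  have hv' : 0 < ‖v‖ := norm_pos_iff.2 hv
  obtain ⟨hint, hval⟩ := integrable_and_integral_norm_pow_mul_add_norm_sq_rpow hd 0
    (a := 1 + q) (c := q / (1 + q) * ‖v‖ ^ 2) (N := N) (by positivity) (by positivity)
    (by simpa using hN)
  simp only [pow_zero, one_mul, Nat.cast_zero, add_zero,
    ← norm_sq_add_mul_norm_sub_sq hq v] at hint hval
  refine ⟨by simpa using hint.comp_sub_right ((q / (1 + q)) • v), ?_⟩
  rw [← integral_add_right_eq_self _ ((q / (1 + q)) • v), hval]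
  have hG : 0 < Gamma ((d : ℝ) / 2) := Gamma_pos_of_pos (by positivity)
  field_simp

theorem integrable_and_integral_inner_mul_add_mul_norm_rpow {d : ℕ} (hd : 0 < d) {q N : ℝ}
    (hq : 0 < q) (hN : (d : ℝ) / 2 + 1 < N) {v : Euc d} (hv : v ≠ 0) :
    Integrable (fun u : Euc d => ⟪u, u - v⟫ * (‖u‖ ^ 2 + q * ‖u - v‖ ^ 2) ^ (-N)) ∧
    ∫ u : Euc d, ⟪u, u - v⟫ * (‖u‖ ^ 2 + q * ‖u - v‖ ^ 2) ^ (-N) =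
      π ^ ((d : ℝ) / 2) * (Gamma (N - (d : ℝ) / 2 - 1) / Gamma N) * (d + 1 - N) *
        (q / (1 + q) * ‖v‖ ^ 2) ^ ((d : ℝ) / 2 + 1 - N) * (1 + q) ^ (-((d : ℝ) / 2 + 1)) := by
  have hd' : (0 : ℝ) < d := by exact_mod_cast hd
  have hv' : 0 < ‖v‖ := norm_pos_iff.2 hv
  set c := q / (1 + q) * ‖v‖ ^ 2
  have hc0 : 0 < c := by positivity
  have ha : 0 < 1 + q := by positivity
  let K : Euc d → ℝ := fun w => (c + ‖w‖ ^ 2 * (1 + q)) ^ (-N)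
  have M := fun (k : ℕ) (hk : ((d : ℝ) + k) / 2 < N) =>
    integrable_and_integral_norm_pow_mul_add_norm_sq_rpow hd k ha hc0 hk
  obtain ⟨i0, v0⟩ := M 0 (by push_cast; linarith)
  obtain ⟨i1, -⟩ := M 1 (by push_cast; linarith)
  obtain ⟨i2, v2⟩ := M 2 (by push_cast; linarith)
  simp only [pow_zero, one_mul, pow_one] at i0 v0 i1
  have iodd : Integrable (fun w : Euc d => ⟪w, v⟫ * K w) := by
    refine (i1.const_mul ‖v‖).mono' (Measurable.aestronglyMeasurable (by fun_prop)) ?_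
    filter_upwards with w
    have hK : 0 ≤ K w := by positivity
    rw [norm_mul, norm_of_nonneg hK, ← mul_assoc, mul_comm ‖v‖]
    exact mul_le_mul_of_nonneg_right (norm_inner_le_norm _ _) hK
  have vodd : ∫ w : Euc d, ⟪w, v⟫ * K w = 0 := by
    have h := integral_neg_eq_self (fun w : Euc d => ⟪w, v⟫ * K w) volume
    simp only [K, inner_neg_left, norm_neg, neg_mul, integral_neg] at h ⊢
    linarith
  have hpt : ∀ w : Euc d, ⟪w + (q / (1 + q)) • v, w + (q / (1 + q)) • v - v⟫ *
      (‖w + (q / (1 + q)) • v‖ ^ 2 + q * ‖w + (q / (1 + q)) • v - v‖ ^ 2) ^ (-N) =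
      ‖w‖ ^ 2 * K w + (q - 1) / (1 + q) * (⟪w, v⟫ * K w) - c * (1 + q)⁻¹ * K w := by
    intro w
    rw [norm_sq_add_mul_norm_sub_sq hq, inner_self_sub_add_smul hq]
    simp only [K]
    ring
  have hI : Integrable (fun w : Euc d =>
      ‖w‖ ^ 2 * K w + (q - 1) / (1 + q) * (⟪w, v⟫ * K w)) := i2.add (iodd.const_mul _)
  refine ⟨?_, ?_⟩
  · have := hI.sub (i0.const_mul (c * (1 + q)⁻¹))
    have := (this.congr (Filter.Eventually.of_forall fun w => (hpt w).symm)).comp_sub_right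
      ((q / (1 + q)) • v)
    simpa using this
  · rw [← integral_add_right_eq_self _ ((q / (1 + q)) • v)]
    simp_rw [hpt]
    rw [integral_sub hI (i0.const_mul _), integral_add i2 (iodd.const_mul _),
      integral_const_mul, integral_const_mul, vodd, v0, v2]
    have hG : 0 < Gamma ((d : ℝ) / 2) := Gamma_pos_of_pos (by positivity)
    have e1 : ((d : ℝ) + (2 : ℕ)) / 2 = (d : ℝ) / 2 + 1 := by push_cast; ring
    have e2 : ((d : ℝ) + (0 : ℕ)) / 2 = (d : ℝ) / 2 := by push_cast; ring
    have e3 : N - ((d : ℝ) / 2 + 1) = N - (d : ℝ) / 2 - 1 := by ring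
    have e4 : Gamma (N - (d : ℝ) / 2) = (N - (d : ℝ) / 2 - 1) * Gamma (N - (d : ℝ) / 2 - 1) := by
      conv_lhs => rw [show N - (d : ℝ) / 2 = (N - (d : ℝ) / 2 - 1) + 1 by ring]
      exact Gamma_add_one (by linarith)
    have e5 : c ^ ((d : ℝ) / 2 + 1 - N) = c * c ^ ((d : ℝ) / 2 - N) := by
      rw [show (d : ℝ) / 2 + 1 - N = 1 + ((d : ℝ) / 2 - N) by ring, rpow_add hc0, rpow_one]
    have e6 : (1 + q) ^ (-((d : ℝ) / 2 + 1)) = (1 + q)⁻¹ * (1 + q) ^ (-((d : ℝ) / 2)) := by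
      rw [neg_add, rpow_add ha, rpow_neg_one, mul_comm]
    rw [e1, e2, e3, e4, e5, e6, Gamma_add_one (by positivity)]
    have hGN : 0 < Gamma N := Gamma_pos_of_pos (by linarith)
    field_simp
    ring

/-- Feynman parametrization of a product of two powers. -/
theorem integrableOn_and_integral_feynman {α β A B : ℝ} (hα : 0 < α) (hβ : 0 < β) (hA : 0 < A)
    (hB : 0 < B) :
    IntegrableOn (fun q : ℝ => q ^ (β - 1) * (A + q * B) ^ (-(α + β))) (Set.Ioi 0) ∧
    ∫ q in Set.Ioi (0 : ℝ), q ^ (β - 1) * (A + q * B) ^ (-(α + β))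
      = Gamma α * Gamma β / Gamma (α + β) * (A ^ (-α) * B ^ (-β)) := by
  have := integrableOn_and_integral_rpow_mul_add_mul_rpow hβ hα hA hB
  rw [add_comm β α] at this
  refine ⟨this.1, this.2.trans (by ring)⟩

/-- The parameter integral left over after the spatial integration. -/
theorem integrableOn_and_integral_rpow_mul_div_one_add {β γ s V : ℝ} (hβ : γ < β)
    (hs : β < s) (hV : 0 < V) :
    IntegrableOn (fun q : ℝ => q ^ (β - 1) * ((q / (1 + q) * V) ^ (-γ) * (1 + q) ^ (-s)))
      (Set.Ioi 0) ∧
    ∫ q in Set.Ioi (0 : ℝ), q ^ (β - 1) * ((q / (1 + q) * V) ^ (-γ) * (1 + q) ^ (-s)) =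
      Gamma (β - γ) * Gamma (s - β) / Gamma (s - γ) * V ^ (-γ) := by
  obtain ⟨hint, hval⟩ := integrableOn_and_integral_rpow_mul_add_mul_rpow
    (sub_pos.2 hβ) (sub_pos.2 hs) one_pos one_pos
  simp only [mul_one, one_rpow] at hint hval
  have hpt : ∀ q ∈ Set.Ioi (0 : ℝ),
      V ^ (-γ) * (q ^ (β - γ - 1) * (1 + q) ^ (-(β - γ + (s - β)))) =
      q ^ (β - 1) * ((q / (1 + q) * V) ^ (-γ) * (1 + q) ^ (-s)) := by
    intro q hq
    have hq : 0 < q := hq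
    have h1 : 0 < 1 + q := by positivity
    rw [mul_rpow (by positivity) hV.le, div_rpow hq.le h1.le,
      show β - γ - 1 = (β - 1) + -γ by ring, rpow_add hq,
      show -(β - γ + (s - β)) = -s - -γ by ring, rpow_sub h1]
    ring
  refine ⟨IntegrableOn.congr_fun (hint.const_mul (V ^ (-γ))) hpt measurableSet_Ioi, ?_⟩
  rw [← setIntegral_congr_fun measurableSet_Ioi hpt, integral_const_mul, hval,
    show β - γ + (s - β) = s - γ by ring]
  ring

theorem integrable_norm_sq_rpow_mul_norm_sub_sq_rpow {d : ℕ} (hd : 0 < d) {α β : ℝ}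
    (hα : 0 < α) (hβ : 0 < β) (hα' : α < (d : ℝ) / 2) (hβ' : β < (d : ℝ) / 2)
    (hαβ : (d : ℝ) / 2 < α + β) {v : Euc d} (hv : v ≠ 0) :
    Integrable (fun u : Euc d => (‖u‖ ^ 2) ^ (-α) * (‖u - v‖ ^ 2) ^ (-β)) := by
  have : Nonempty (Fin d) := ⟨⟨0, hd⟩⟩
  have hv' : 0 < ‖v‖ := norm_pos_iff.2 hv
  let f : ℝ → Euc d → ℝ := fun q u =>
    q ^ (β - 1) * (‖u‖ ^ 2 + q * ‖u - v‖ ^ 2) ^ (-(α + β))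
  have hf : AEStronglyMeasurable (Function.uncurry f)
      ((volume.restrict (Set.Ioi (0 : ℝ))).prod volume) := by
    refine Measurable.aestronglyMeasurable ?_
    simp only [f, Function.uncurry_def]
    fun_prop
  have key := integrable_and_integral_swap_of_nonneg hf
    (by
      filter_upwards [ae_restrict_mem measurableSet_Ioi] with q hq
      have hq : 0 < q := hq
      filter_upwards with u
      positivity)
    (by
      filter_upwards [ae_restrict_mem measurableSet_Ioi] with q hq
      exact (integrable_and_integral_add_mul_norm_rpow hd hq hαβ hv).1.const_mul _)
    (by
      have hc := (integrableOn_and_integral_rpow_mul_div_one_add (β := β)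
        (γ := α + β - (d : ℝ) / 2) (s := (d : ℝ) / 2) (V := ‖v‖ ^ 2)
        (by linarith) (by linarith) (by positivity)).1
      refine Integrable.congr (hc.const_mul
        (π ^ ((d : ℝ) / 2) * (Gamma (α + β - (d : ℝ) / 2) / Gamma (α + β)))) ?_
      filter_upwards [ae_restrict_mem measurableSet_Ioi] with q hq
      simp only [f]
      rw [integral_const_mul, (integrable_and_integral_add_mul_norm_rpow hd hq hαβ hv).2, neg_sub]
      ring)
  have hG : 0 < Gamma α * Gamma β / Gamma (α + β) := by
    have := Gamma_pos_of_pos hα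
    have := Gamma_pos_of_pos hβ
    have := Gamma_pos_of_pos (add_pos hα hβ)
    positivity
  refine (key.1.const_mul (Gamma α * Gamma β / Gamma (α + β))⁻¹).congr ?_
  filter_upwards [compl_mem_ae_iff.2 (measure_singleton (0 : Euc d)),
    compl_mem_ae_iff.2 (measure_singleton v)] with u hu huv
  have h1 : 0 < ‖u‖ := norm_pos_iff.2 hu
  have h2 : 0 < ‖u - v‖ := norm_pos_iff.2 (sub_ne_zero.2 huv)
  simp only [f]
  rw [(integrableOn_and_integral_feynman hα hβ (by positivity) (by positivity)).2,
    inv_mul_cancel_left₀ hG.ne']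

/-- A numerator vanishing to first order at both poles makes the two-centre kernel integrable. -/
theorem integrable_mul_rpow_mul_rpow_of_abs_le {d : ℕ} (hd : 0 < d) {α β : ℝ}
    (hα' : α < (d : ℝ) / 2 + 1 / 2)
    (hβ' : β < (d : ℝ) / 2 + 1 / 2) (hαβ : (d : ℝ) / 2 + 1 < α + β) {v : Euc d} (hv : v ≠ 0)
    {g : Euc d → ℝ} (C : ℝ) (hg : Measurable g)
    (hgC : ∀ᵐ u, |g u| ≤ C * (‖u‖ * ‖u - v‖)) :
    Integrable (fun u : Euc d => g u * ((‖u‖ ^ 2) ^ (-α) * (‖u - v‖ ^ 2) ^ (-β))) := by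
  have : Nonempty (Fin d) := ⟨⟨0, hd⟩⟩
  refine ((integrable_norm_sq_rpow_mul_norm_sub_sq_rpow hd (α := α - 1 / 2) (β := β - 1 / 2)
    (by linarith) (by linarith) (by linarith) (by linarith) (by linarith) hv).const_mul C).mono'
    (Measurable.aestronglyMeasurable (by fun_prop)) ?_
  filter_upwards [hgC, compl_mem_ae_iff.2 (measure_singleton (0 : Euc d)),
    compl_mem_ae_iff.2 (measure_singleton v)] with u hu h1 h2
  have h1 : 0 < ‖u‖ := norm_pos_iff.2 h1
  have h2 : 0 < ‖u - v‖ := norm_pos_iff.2 (sub_ne_zero.2 h2)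
  have e : ∀ {r a : ℝ}, 0 < r → (r ^ 2) ^ (-(a - 1 / 2)) = r * (r ^ 2) ^ (-a) := by
    intro r a hr
    rw [neg_sub, sub_eq_add_neg, rpow_add (by positivity), ← sqrt_eq_rpow, sqrt_sq hr.le]
  rw [norm_mul, norm_of_nonneg (r := (‖u‖ ^ 2) ^ (-α) * (‖u - v‖ ^ 2) ^ (-β)) (by positivity),
    e h1, e h2]
  calc |g u| * ((‖u‖ ^ 2) ^ (-α) * (‖u - v‖ ^ 2) ^ (-β))
      ≤ (C * (‖u‖ * ‖u - v‖)) * ((‖u‖ ^ 2) ^ (-α) * (‖u - v‖ ^ 2) ^ (-β)) :=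
        mul_le_mul_of_nonneg_right hu (by positivity)
    _ = _ := by ring

/-- The convolution of two vector-valued homogeneous kernels, contracted with the inner
product. -/
theorem integrable_and_integral_inner_mul_rpow_mul_rpow {d : ℕ} (hd : 0 < d) {α β : ℝ}
    (hα' : α < (d : ℝ) / 2 + 1 / 2)
    (hβ' : β < (d : ℝ) / 2 + 1 / 2) (hαβ : (d : ℝ) / 2 + 1 < α + β)
    {v : Euc d} (hv : v ≠ 0) :
    Integrable (fun u : Euc d => ⟪u, u - v⟫ * ((‖u‖ ^ 2) ^ (-α) * (‖u - v‖ ^ 2) ^ (-β))) ∧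
    ∫ u : Euc d, ⟪u, u - v⟫ * ((‖u‖ ^ 2) ^ (-α) * (‖u - v‖ ^ 2) ^ (-β)) =
      π ^ ((d : ℝ) / 2) * (Gamma (α + β - (d : ℝ) / 2 - 1) / Gamma (d + 1 - (α + β))) *
        (Gamma ((d : ℝ) / 2 + 1 - α) / Gamma α) * (Gamma ((d : ℝ) / 2 + 1 - β) / Gamma β) *
        (‖v‖ ^ 2) ^ ((d : ℝ) / 2 + 1 - (α + β)) := by
  have : Nonempty (Fin d) := ⟨⟨0, hd⟩⟩
  have hv' : 0 < ‖v‖ := norm_pos_iff.2 hv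
  have hα0 : 0 < α := by linarith
  have hβ0 : 0 < β := by linarith
  have hGα := Gamma_pos_of_pos hα0
  have hGβ := Gamma_pos_of_pos hβ0
  have hGαβ := Gamma_pos_of_pos (add_pos hα0 hβ0)
  have hne : ∀ᵐ u : Euc d, 0 < ‖u‖ ∧ 0 < ‖u - v‖ := by
    filter_upwards [compl_mem_ae_iff.2 (measure_singleton (0 : Euc d)),
      compl_mem_ae_iff.2 (measure_singleton v)] with u hu huv
    exact ⟨norm_pos_iff.2 hu, norm_pos_iff.2 (sub_ne_zero.2 huv)⟩
  have hint := integrable_mul_rpow_mul_rpow_of_abs_le hd hα' hβ' hαβ hv 1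
    (g := fun u : Euc d => ⟪u, u - v⟫) (by fun_prop)
    (Filter.Eventually.of_forall fun u => by simpa using abs_real_inner_le_norm u (u - v))
  refine ⟨hint, ?_⟩
  let f : Euc d → ℝ → ℝ := fun u q =>
    ⟪u, u - v⟫ * (q ^ (β - 1) * (‖u‖ ^ 2 + q * ‖u - v‖ ^ 2) ^ (-(α + β)))
  have hf : AEStronglyMeasurable (Function.uncurry f)
      (volume.prod (volume.restrict (Set.Ioi (0 : ℝ)))) := by
    refine Measurable.aestronglyMeasurable ?_
    simp only [f, Function.uncurry_def]
    fun_prop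
  have hfI : Integrable (Function.uncurry f)
      (volume.prod (volume.restrict (Set.Ioi (0 : ℝ)))) := by
    refine (integrable_prod_iff hf).2 ⟨?_, ?_⟩
    · filter_upwards [hne] with u ⟨h1, h2⟩
      exact (integrableOn_and_integral_feynman hα0 hβ0 (pow_pos h1 2) (pow_pos h2 2)).1.const_mul
        ⟪u, u - v⟫
    · refine (hint.norm.const_mul (Gamma α * Gamma β / Gamma (α + β))).congr ?_
      filter_upwards [hne] with u ⟨h1, h2⟩
      have : ∀ q ∈ Set.Ioi (0 : ℝ), ‖Function.uncurry f (u, q)‖ =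
          |⟪u, u - v⟫| * (q ^ (β - 1) * (‖u‖ ^ 2 + q * ‖u - v‖ ^ 2) ^ (-(α + β))) := by
        intro q hq
        have hq : 0 < q := hq
        simp only [f, Function.uncurry, norm_mul, norm_eq_abs]
        rw [abs_of_nonneg (a := q ^ (β - 1)) (by positivity),
          abs_of_nonneg (a := (‖u‖ ^ 2 + q * ‖u - v‖ ^ 2) ^ (-(α + β))) (by positivity)]
      rw [setIntegral_congr_fun measurableSet_Ioi this, integral_const_mul,
        (integrableOn_and_integral_feynman hα0 hβ0 (pow_pos h1 2) (pow_pos h2 2)).2,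
        norm_mul, norm_of_nonneg (r := (‖u‖ ^ 2) ^ (-α) * (‖u - v‖ ^ 2) ^ (-β)) (by positivity),
        norm_eq_abs]
      ring
  have hswap := integral_integral_swap hfI
  have hL : ∫ u : Euc d, ∫ q in Set.Ioi (0 : ℝ), f u q = Gamma α * Gamma β / Gamma (α + β) *
      ∫ u : Euc d, ⟪u, u - v⟫ * ((‖u‖ ^ 2) ^ (-α) * (‖u - v‖ ^ 2) ^ (-β)) := by
    rw [← integral_const_mul]
    refine integral_congr_ae ?_
    filter_upwards [hne] with u ⟨h1, h2⟩
    simp only [f]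
    rw [integral_const_mul,
      (integrableOn_and_integral_feynman hα0 hβ0 (pow_pos h1 2) (pow_pos h2 2)).2]
    ring
  have hR : ∀ q ∈ Set.Ioi (0 : ℝ), ∫ u : Euc d, f u q =
      π ^ ((d : ℝ) / 2) * (Gamma (α + β - (d : ℝ) / 2 - 1) / Gamma (α + β)) *
        (d + 1 - (α + β)) * (q ^ (β - 1) * ((q / (1 + q) * ‖v‖ ^ 2) ^
          (-(α + β - (d : ℝ) / 2 - 1)) * (1 + q) ^ (-((d : ℝ) / 2 + 1)))) := by
    intro q hq
    have : ∀ u : Euc d, f u q = q ^ (β - 1) *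
        (⟪u, u - v⟫ * (‖u‖ ^ 2 + q * ‖u - v‖ ^ 2) ^ (-(α + β))) := by
      intro u
      simp only [f]
      ring
    simp_rw [this]
    rw [integral_const_mul, (integrable_and_integral_inner_mul_add_mul_norm_rpow hd hq hαβ hv).2,
      show -(α + β - (d : ℝ) / 2 - 1) = (d : ℝ) / 2 + 1 - (α + β) by ring]
    ring
  rw [hL, setIntegral_congr_fun measurableSet_Ioi hR, integral_const_mul,
    (integrableOn_and_integral_rpow_mul_div_one_add (by linarith) (by linarith)
      (by positivity)).2] at hswap
  have e1 : β - (α + β - (d : ℝ) / 2 - 1) = (d : ℝ) / 2 + 1 - α := by ring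
  have e2 : (d : ℝ) / 2 + 1 - (α + β - (d : ℝ) / 2 - 1) = d + 1 - (α + β) + 1 := by ring
  have e3 : -(α + β - (d : ℝ) / 2 - 1) = (d : ℝ) / 2 + 1 - (α + β) := by ring
  have hδ : 0 < d + 1 - (α + β) := by linarith
  have hGδ := Gamma_pos_of_pos hδ
  rw [e1, e2, e3, Gamma_add_one hδ.ne'] at hswap
  field_simp at hswap ⊢
  linear_combination hswap

/-- A linear function vanishing on `v` integrates to zero against a kernel that is symmetric
about the axis `ℝ v`. -/
theorem integral_inner_mul_rpow_mul_rpow_eq_zero {d : ℕ} (α β : ℝ) {n v : Euc d}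
    (hn : ⟪n, v⟫ = 0) :
    ∫ u : Euc d, ⟪n, u⟫ * ((‖u‖ ^ 2) ^ (-α) * (‖u - v‖ ^ 2) ^ (-β)) = 0 := by
  let ρ : Euc d ≃ₗᵢ[ℝ] Euc d := (ℝ ∙ n)ᗮ.reflection
  have hρn : ρ n = -n := Submodule.reflection_orthogonalComplement_singleton_eq_neg n
  have hρv : ρ v = v := Submodule.reflection_mem_subspace_eq_self
    (Submodule.mem_orthogonal_singleton_iff_inner_right.2 hn)
  have h := ρ.measurePreserving.integral_comp ρ.toHomeomorph.measurableEmbedding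
    (fun u : Euc d => ⟪n, u⟫ * ((‖u‖ ^ 2) ^ (-α) * (‖u - v‖ ^ 2) ^ (-β)))
  have hpt : ∀ u : Euc d, ⟪n, ρ u⟫ * ((‖ρ u‖ ^ 2) ^ (-α) * (‖ρ u - v‖ ^ 2) ^ (-β)) =
      -(⟪n, u⟫ * ((‖u‖ ^ 2) ^ (-α) * (‖u - v‖ ^ 2) ^ (-β))) := by
    intro u
    have h1 : ⟪n, ρ u⟫ = -⟪n, u⟫ := by
      rw [← ρ.inner_map_map n u, hρn, inner_neg_left, neg_neg]
    have h2 : ‖ρ u - v‖ = ‖u - v‖ := by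
      rw [← ρ.norm_map (u - v), map_sub, hρv]
    rw [h1, h2, ρ.norm_map]
    ring
  simp_rw [hpt] at h
  rw [integral_neg] at h
  linarith

theorem inversion_zero_one_eq_smul {d : ℕ} (s : Euc d) :
    EuclideanGeometry.inversion 0 1 s = (‖s‖ ^ 2)⁻¹ • s := by
  simp [EuclideanGeometry.inversion]

/-- Change of variables under the inversion in the unit sphere. -/
theorem integrable_iff_and_integral_eq_inversion {d : ℕ} (hd : 0 < d) (F : Euc d → ℝ) :
    (Integrable F ↔ Integrable (fun s : Euc d => ((‖s‖ ^ 2)⁻¹) ^ d * F ((‖s‖ ^ 2)⁻¹ • s))) ∧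
    ∫ t, F t = ∫ s : Euc d, ((‖s‖ ^ 2)⁻¹) ^ d * F ((‖s‖ ^ 2)⁻¹ • s) := by
  have : Nonempty (Fin d) := ⟨⟨0, hd⟩⟩
  have hbij : Function.Bijective (EuclideanGeometry.inversion (0 : Euc d) 1) :=
    (EuclideanGeometry.inversion_involutive (0 : Euc d) one_ne_zero).bijective
  have himg : EuclideanGeometry.inversion (0 : Euc d) 1 '' {0}ᶜ = {0}ᶜ := by
    rw [Set.image_compl_eq hbij, Set.image_singleton, EuclideanGeometry.inversion_self]
  have hder : ∀ s ∈ ({0}ᶜ : Set (Euc d)),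
      HasFDerivWithinAt (EuclideanGeometry.inversion (0 : Euc d) 1)
        ((1 / dist s 0) ^ 2 • ((ℝ ∙ (s - 0))ᗮ.reflection : Euc d →L[ℝ] Euc d)) {0}ᶜ s :=
    fun s hs => (EuclideanGeometry.hasFDerivAt_inversion hs).hasFDerivWithinAt
  have hdet : ∀ s : Euc d, |((1 / dist s 0) ^ 2 •
      ((ℝ ∙ (s - 0))ᗮ.reflection : Euc d →L[ℝ] Euc d)).det| = ((‖s‖ ^ 2)⁻¹) ^ d := by
    intro s
    have h1 : |LinearMap.det ((ℝ ∙ (s - 0))ᗮ.reflection.toLinearMap)| = 1 := by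
      rw [Submodule.det_reflection, abs_pow, abs_neg, abs_one, one_pow]
    rw [ContinuousLinearMap.det, ContinuousLinearMap.toLinearMap_smul, LinearMap.det_smul,
      finrank_euclideanSpace_fin, abs_mul]
    refine (congrArg _ h1).trans ?_
    rw [mul_one, abs_of_nonneg (by positivity), dist_zero_right, one_div, inv_pow]
  have hms : MeasurableSet ({0}ᶜ : Set (Euc d)) := (measurableSet_singleton 0).compl
  have hI := integrableOn_image_iff_integrableOn_abs_det_fderiv_smul volume hms hder
    hbij.injective.injOn F
  have hE := integral_image_eq_integral_abs_det_fderiv_smul volume hms hder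
    hbij.injective.injOn F
  rw [himg] at hI hE
  simpa only [hdet, IntegrableOn, restrict_compl_singleton, smul_eq_mul,
    inversion_zero_one_eq_smul] using And.intro hI hE

theorem norm_sub_inversion {d : ℕ} {p s : Euc d} (hp : p ≠ 0) (hs : s ≠ 0) :
    ‖p - (‖s‖ ^ 2)⁻¹ • s‖ = ‖p‖ * ‖s - (‖p‖ ^ 2)⁻¹ • p‖ / ‖s‖ := by
  have hp' : ‖p‖ ≠ 0 := norm_ne_zero_iff.2 hp
  have hs' : ‖s‖ ≠ 0 := norm_ne_zero_iff.2 hs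
  rw [← sq_eq_sq₀ (by positivity) (by positivity), div_pow, mul_pow, norm_sub_sq_real,
    norm_sub_sq_real, norm_smul, norm_smul, real_inner_smul_right, real_inner_smul_right,
    norm_of_nonneg (by positivity), norm_of_nonneg (by positivity), real_inner_comm s p]
  field_simp

theorem inner_sub_inversion {d : ℕ} (p r : Euc d) {s : Euc d} (hs : s ≠ 0) :
    ⟪p - (‖s‖ ^ 2)⁻¹ • s, r - (‖s‖ ^ 2)⁻¹ • s⟫ =
      (⟪p, r⟫ * ‖s‖ ^ 2 - ⟪p, s⟫ - ⟪r, s⟫ + 1) / ‖s‖ ^ 2 := by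
  have hs' : ‖s‖ ≠ 0 := norm_ne_zero_iff.2 hs
  simp only [inner_sub_left, inner_sub_right, real_inner_smul_left, real_inner_smul_right,
    real_inner_comm r s]
  simp only [real_inner_self_eq_norm_sq]
  field_simp
  ring

/-- Splitting of the inverted numerator into a conformally covariant part and a part linear in
the direction orthogonal to the axis through the two inverted centres. -/
theorem exists_orthogonal_inverted_numerator {d : ℕ} {p r : Euc d} (hp : p ≠ 0) (hr : r ≠ 0) :
    ∃ n : Euc d, ⟪n, (‖r‖ ^ 2)⁻¹ • r - (‖p‖ ^ 2)⁻¹ • p⟫ = 0 ∧ ∀ u : Euc d,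
      ⟪p, r⟫ * ‖u + (‖p‖ ^ 2)⁻¹ • p‖ ^ 2 - ⟪p, u + (‖p‖ ^ 2)⁻¹ • p⟫ -
        ⟪r, u + (‖p‖ ^ 2)⁻¹ • p⟫ + 1 =
      ⟪p, r⟫ * ⟪u, u - ((‖r‖ ^ 2)⁻¹ • r - (‖p‖ ^ 2)⁻¹ • p)⟫ + ⟪n, u⟫ := by
  have hp' : ‖p‖ ≠ 0 := norm_ne_zero_iff.2 hp
  have hr' : ‖r‖ ≠ 0 := norm_ne_zero_iff.2 hr
  refine ⟨⟪p, r⟫ • ((‖p‖ ^ 2)⁻¹ • p + (‖r‖ ^ 2)⁻¹ • r) - p - r, ?_, fun u => ?_⟩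
  · simp only [inner_sub_left, inner_sub_right, inner_add_left, real_inner_smul_left,
      real_inner_smul_right, real_inner_self_eq_norm_sq, real_inner_comm p r]
    field_simp
    ring
  · simp only [← real_inner_self_eq_norm_sq, inner_sub_left, inner_sub_right, inner_add_left,
      inner_add_right, real_inner_smul_left, real_inner_smul_right, real_inner_comm p r,
      real_inner_comm u p, real_inner_comm u r]
    simp only [real_inner_self_eq_norm_sq]
    field_simp
    ring

theorem inversion_kernel_eq {d : ℕ} {p r s : Euc d} (hp : p ≠ 0) (hr : r ≠ 0) (hs : s ≠ 0)
    (hsp : s ≠ (‖p‖ ^ 2)⁻¹ • p) (hsr : s ≠ (‖r‖ ^ 2)⁻¹ • r) {a b e : ℝ}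
    (hsum : a + b + e = 2 * d + 2) :
    ((‖s‖ ^ 2)⁻¹) ^ d * (⟪p - (‖s‖ ^ 2)⁻¹ • s, r - (‖s‖ ^ 2)⁻¹ • s⟫ /
      (‖p - (‖s‖ ^ 2)⁻¹ • s‖ ^ a * ‖r - (‖s‖ ^ 2)⁻¹ • s‖ ^ b * ‖(‖s‖ ^ 2)⁻¹ • s‖ ^ e)) =
    (‖p‖ ^ a * ‖r‖ ^ b)⁻¹ * ((⟪p, r⟫ * ‖s‖ ^ 2 - ⟪p, s⟫ - ⟪r, s⟫ + 1) *
      ((‖s - (‖p‖ ^ 2)⁻¹ • p‖ ^ 2) ^ (-(a / 2)) * (‖s - (‖r‖ ^ 2)⁻¹ • r‖ ^ 2) ^ (-(b / 2)))) := by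
  have hs' : 0 < ‖s‖ := norm_pos_iff.2 hs
  have hp' : 0 < ‖p‖ := norm_pos_iff.2 hp
  have hr' : 0 < ‖r‖ := norm_pos_iff.2 hr
  have hsp' : 0 < ‖s - (‖p‖ ^ 2)⁻¹ • p‖ := norm_pos_iff.2 (sub_ne_zero.2 hsp)
  have hsr' : 0 < ‖s - (‖r‖ ^ 2)⁻¹ • r‖ := norm_pos_iff.2 (sub_ne_zero.2 hsr)
  have hn : ‖(‖s‖ ^ 2)⁻¹ • s‖ = ‖s‖⁻¹ := by
    rw [norm_smul, norm_of_nonneg (by positivity)]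
    field_simp
  have hhalf : ∀ {ρ : ℝ} (c : ℝ), 0 < ρ → (ρ ^ 2) ^ (-(c / 2)) = (ρ ^ c)⁻¹ := by
    intro ρ c hρ
    rw [← rpow_natCast, ← rpow_mul hρ.le, ← rpow_neg hρ.le]
    congr 1
    push_cast
    ring
  have hpow : ‖s‖ ^ a * ‖s‖ ^ b * ‖s‖ ^ e = (‖s‖ ^ 2) ^ d * ‖s‖ ^ 2 := by
    rw [← rpow_add hs', ← rpow_add hs', hsum, rpow_add hs', ← pow_mul, ← rpow_natCast _ (2 * d),
      ← rpow_natCast _ 2]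
    push_cast
    rfl
  rw [norm_sub_inversion hp hs, norm_sub_inversion hr hs, inner_sub_inversion p r hs, hn,
    hhalf a hsp', hhalf b hsr', div_rpow (by positivity) hs'.le, div_rpow (by positivity) hs'.le,
    mul_rpow hp'.le hsp'.le, mul_rpow hr'.le hsr'.le, inv_rpow hs'.le, inv_pow]
  generalize ⟪p, r⟫ * ‖s‖ ^ 2 - ⟪p, s⟫ - ⟪r, s⟫ + 1 = M
  have h1 : ‖s‖ ^ a ≠ 0 := by positivity
  have h2 : ‖s‖ ^ b ≠ 0 := by positivity
  have h3 : ‖s‖ ^ e ≠ 0 := by positivity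
  have h4 : ‖p‖ ^ a ≠ 0 := by positivity
  have h5 : ‖r‖ ^ b ≠ 0 := by positivity
  have h6 : ‖s - (‖p‖ ^ 2)⁻¹ • p‖ ^ a ≠ 0 := by positivity
  have h7 : ‖s - (‖r‖ ^ 2)⁻¹ • r‖ ^ b ≠ 0 := by positivity
  have h8 : (‖s‖ ^ 2) ^ d ≠ 0 := by positivity
  have h9 : ‖s‖ ^ 2 ≠ 0 := by positivity
  generalize ‖s - (‖p‖ ^ 2)⁻¹ • p‖ ^ a = Y₁ at *
  generalize ‖s - (‖r‖ ^ 2)⁻¹ • r‖ ^ b = Y₂ at *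
  generalize ‖s‖ ^ a = X₁ at *
  generalize ‖s‖ ^ b = X₂ at *
  generalize ‖s‖ ^ e = X₃ at *
  generalize (‖s‖ ^ 2) ^ d = X₄ at *
  generalize ‖s‖ ^ 2 = X₅ at *
  field_simp
  linear_combination M * hpow

/-- Bookkeeping of the constant and of the powers of the distances after the inversion. -/
theorem angular_constant_eq {d : ℕ} {d₁ d₂ d₃ : ℝ} (hsum : d₁ + d₂ + d₃ = 2 * (d : ℝ))
    {a b ℓ : ℝ} (ha : 0 < a) (hb : 0 < b) (hℓ : 0 < ℓ) (m : ℝ) :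
    (a ^ (d₂ + 1) * b ^ (d₃ + 1))⁻¹ * (m * (π ^ ((d : ℝ) / 2) *
      (Gamma ((d₂ + 1) / 2 + (d₃ + 1) / 2 - (d : ℝ) / 2 - 1) /
        Gamma (d + 1 - ((d₂ + 1) / 2 + (d₃ + 1) / 2))) *
      (Gamma ((d : ℝ) / 2 + 1 - (d₂ + 1) / 2) / Gamma ((d₂ + 1) / 2)) *
      (Gamma ((d : ℝ) / 2 + 1 - (d₃ + 1) / 2) / Gamma ((d₃ + 1) / 2)) *
      (ℓ ^ 2) ^ ((d : ℝ) / 2 + 1 - ((d₂ + 1) / 2 + (d₃ + 1) / 2)))) =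
    CMOZ d₁ d₂ d₃ d * (m / (a ^ ((d : ℝ) - d₃ + 1) * b ^ ((d : ℝ) - d₂ + 1) *
      (a * b * ℓ) ^ ((d : ℝ) - d₁))) := by
  have e1 : (d₂ + 1) / 2 + (d₃ + 1) / 2 - (d : ℝ) / 2 - 1 = ((d : ℝ) - d₁) / 2 := by linarith
  have e2 : (d : ℝ) + 1 - ((d₂ + 1) / 2 + (d₃ + 1) / 2) = d₁ / 2 := by linarith
  have e3 : (d : ℝ) / 2 + 1 - (d₂ + 1) / 2 = ((d : ℝ) - d₂ + 1) / 2 := by ring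
  have e4 : (d : ℝ) / 2 + 1 - (d₃ + 1) / 2 = ((d : ℝ) - d₃ + 1) / 2 := by ring
  have e5 : (ℓ ^ 2) ^ ((d : ℝ) / 2 + 1 - ((d₂ + 1) / 2 + (d₃ + 1) / 2)) =
      (ℓ ^ ((d : ℝ) - d₁))⁻¹ := by
    rw [← rpow_natCast, ← rpow_mul hℓ.le, ← rpow_neg hℓ.le]
    congr 1
    push_cast
    linarith
  have e6 : a ^ (d₂ + 1) = a ^ ((d : ℝ) - d₃ + 1) * a ^ ((d : ℝ) - d₁) := by
    rw [← rpow_add ha]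
    congr 1
    linarith
  have e7 : b ^ (d₃ + 1) = b ^ ((d : ℝ) - d₂ + 1) * b ^ ((d : ℝ) - d₁) := by
    rw [← rpow_add hb]
    congr 1
    linarith
  rw [CMOZ]
  rw [e1, e2, e3, e4, e5, e6, e7, mul_rpow (by positivity) hℓ.le,
    mul_rpow ha.le hb.le]
  field_simp

/-- The identity with the third centre at the origin. -/
theorem integrable_and_integral_angular_kernel_zero {d : ℕ} (hd : 0 < d) {p r : Euc d}
    (hp : p ≠ 0) (hr : r ≠ 0) (hpr : p ≠ r) {d₁ d₂ d₃ : ℝ} (h₁ : d₁ < d) (h₂ : d₂ < d)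
    (h₃ : d₃ < d) (hsum : d₁ + d₂ + d₃ = 2 * (d : ℝ)) :
    Integrable (fun t : Euc d =>
      ⟪p - t, r - t⟫ / (‖p - t‖ ^ (d₂ + 1) * ‖r - t‖ ^ (d₃ + 1) * ‖t‖ ^ d₁)) ∧
    ∫ t : Euc d, ⟪p - t, r - t⟫ / (‖p - t‖ ^ (d₂ + 1) * ‖r - t‖ ^ (d₃ + 1) * ‖t‖ ^ d₁) =
      CMOZ d₁ d₂ d₃ d * (⟪p, r⟫ / (‖p‖ ^ ((d : ℝ) - d₃ + 1) * ‖r‖ ^ ((d : ℝ) - d₂ + 1) *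
        ‖p - r‖ ^ ((d : ℝ) - d₁))) := by
  have : Nonempty (Fin d) := ⟨⟨0, hd⟩⟩
  have hp' : 0 < ‖p‖ := norm_pos_iff.2 hp
  have hr' : 0 < ‖r‖ := norm_pos_iff.2 hr
  have hpr' : 0 < ‖p - r‖ := norm_pos_iff.2 (sub_ne_zero.2 hpr)
  obtain ⟨n, hn, hsplit⟩ := exists_orthogonal_inverted_numerator hp hr
  set P : Euc d := (‖p‖ ^ 2)⁻¹ • p with hP
  set R : Euc d := (‖r‖ ^ 2)⁻¹ • r with hR
  have hnR : ‖R‖ = ‖r‖⁻¹ := by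
    rw [hR, norm_smul, norm_of_nonneg (by positivity)]
    field_simp
  have hR0 : R ≠ 0 := norm_pos_iff.1 (by rw [hnR]; positivity)
  have hRr : (‖R‖ ^ 2)⁻¹ • R = r := by
    rw [hnR, hR, smul_smul]
    field_simp
    rw [one_smul]
  have hdist : ‖p - r‖ = ‖p‖ * ‖r‖ * ‖R - P‖ := by
    have h := norm_sub_inversion hp hR0
    rw [hRr, hnR] at h
    rw [h, div_inv_eq_mul]
    ring
  have hv : R - P ≠ 0 := by
    intro h
    rw [h, norm_zero, mul_zero] at hdist
    exact hpr'.ne' hdist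
  have hvn : 0 < ‖R - P‖ := norm_pos_iff.2 hv
  set F : Euc d → ℝ := fun t =>
    ⟪p - t, r - t⟫ / (‖p - t‖ ^ (d₂ + 1) * ‖r - t‖ ^ (d₃ + 1) * ‖t‖ ^ d₁)
  let K : Euc d → ℝ := fun u =>
    (‖u‖ ^ 2) ^ (-((d₂ + 1) / 2)) * (‖u - (R - P)‖ ^ 2) ^ (-((d₃ + 1) / 2))
  let A : ℝ := (‖p‖ ^ (d₂ + 1) * ‖r‖ ^ (d₃ + 1))⁻¹
  let G : Euc d → ℝ := fun s => ((‖s‖ ^ 2)⁻¹) ^ d * F ((‖s‖ ^ 2)⁻¹ • s)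
  obtain ⟨hkI, hkE⟩ := integrable_iff_and_integral_eq_inversion hd F
  have hne : ∀ᵐ u : Euc d, u + P ≠ 0 ∧ u + P ≠ P ∧ u + P ≠ R := by
    filter_upwards [compl_mem_ae_iff.2 (measure_singleton (-P)),
      compl_mem_ae_iff.2 (measure_singleton (0 : Euc d)),
      compl_mem_ae_iff.2 (measure_singleton (R - P))] with u h1 h2 h3
    exact ⟨fun h => h1 (eq_neg_of_add_eq_zero_left h), fun h => h2 (by simpa using h),
      fun h => h3 (eq_sub_of_add_eq h)⟩
  have hGae : ∀ᵐ u : Euc d, G (u + P) =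
      A * ((⟪p, r⟫ * ⟪u, u - (R - P)⟫ + ⟪n, u⟫) * K u) := by
    filter_upwards [hne] with u ⟨h1, h2, h3⟩
    have h := inversion_kernel_eq hp hr h1 h2 h3 (a := d₂ + 1) (b := d₃ + 1) (e := d₁)
      (by linarith)
    rw [← hP, ← hR, hsplit u] at h
    simp only [G, F, A, K]
    rw [h, add_sub_cancel_right, show u + P - R = u - (R - P) by abel]
  have hbound : ∀ᵐ u : Euc d, |⟪p, r⟫ * ⟪u, u - (R - P)⟫ + ⟪n, u⟫| ≤
      ‖p‖ * ‖r‖ * (‖u‖ * ‖u - (R - P)‖) := by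
    filter_upwards [hne] with u ⟨h1, h2, h3⟩
    have hs : 0 < ‖u + P‖ := norm_pos_iff.2 h1
    have h := abs_real_inner_le_norm (p - (‖u + P‖ ^ 2)⁻¹ • (u + P))
      (r - (‖u + P‖ ^ 2)⁻¹ • (u + P))
    rw [inner_sub_inversion p r h1, norm_sub_inversion hp h1, norm_sub_inversion hr h1, hsplit u,
      ← hP, ← hR, add_sub_cancel_right, show u + P - R = u - (R - P) by abel, abs_div,
      abs_of_pos (pow_pos hs 2), div_mul_div_comm, ← sq,
      div_le_div_iff_of_pos_right (pow_pos hs 2)] at h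
    linarith
  have hα' : (d₂ + 1) / 2 < (d : ℝ) / 2 + 1 / 2 := by linarith
  have hβ' : (d₃ + 1) / 2 < (d : ℝ) / 2 + 1 / 2 := by linarith
  have hαβ : (d : ℝ) / 2 + 1 < (d₂ + 1) / 2 + (d₃ + 1) / 2 := by linarith
  have hI := integrable_mul_rpow_mul_rpow_of_abs_le hd hα' hβ' hαβ hv (‖p‖ * ‖r‖)
    (by fun_prop) hbound
  obtain ⟨hJ, hJval⟩ := integrable_and_integral_inner_mul_rpow_mul_rpow hd hα' hβ' hαβ hv
  have hodd := integral_inner_mul_rpow_mul_rpow_eq_zero ((d₂ + 1) / 2) ((d₃ + 1) / 2) hn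
  have hGI : Integrable fun u => G (u + P) :=
    (hI.const_mul A).congr (hGae.mono fun u hu => hu.symm)
  refine ⟨hkI.2 (by simpa only [sub_add_cancel] using hGI.comp_sub_right P), ?_⟩
  have hval : ∫ u : Euc d, (⟪p, r⟫ * ⟪u, u - (R - P)⟫ + ⟪n, u⟫) * K u =
      ⟪p, r⟫ * ∫ u : Euc d, ⟪u, u - (R - P)⟫ * K u := by
    have h1 : Integrable fun u : Euc d => ⟪p, r⟫ * (⟪u, u - (R - P)⟫ * K u) := hJ.const_mul _
    have h2 : ∀ u : Euc d, (⟪p, r⟫ * ⟪u, u - (R - P)⟫ + ⟪n, u⟫) * K u =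
        ⟪p, r⟫ * (⟪u, u - (R - P)⟫ * K u) + ⟪n, u⟫ * K u := fun u => by ring
    have h3 : Integrable fun u : Euc d => ⟪n, u⟫ * K u := by
      refine (hI.sub h1).congr (Filter.Eventually.of_forall fun u => ?_)
      simp only [K, Pi.sub_apply]
      ring
    simp_rw [h2]
    rw [integral_add h1 h3, integral_const_mul, hodd, add_zero]
  rw [hkE, ← integral_add_right_eq_self _ P]
  refine (integral_congr_ae hGae).trans ?_
  rw [integral_const_mul, hval, hJval]
  rw [hdist]
  exact angular_constant_eq hsum hp' hr' hvn _

/-- **Theorem 1.2** (angular Selberg-type correlation identity). -/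
theorem angular_selberg_identity
    (d : ℕ) (hd : 2 ≤ d) (x y z : Euc d)
    (hxy : x ≠ y) (hxz : x ≠ z) (hyz : y ≠ z)
    (d₁ d₂ d₃ : ℝ) (h₁ : d₁ ∈ Set.Ioo (0:ℝ) (d:ℝ)) (h₂ : d₂ ∈ Set.Ioo (0:ℝ) (d:ℝ))
    (h₃ : d₃ ∈ Set.Ioo (0:ℝ) (d:ℝ)) (hsum : d₁ + d₂ + d₃ = 2*(d:ℝ)) :
    Integrable (fun t : Euc d =>
      ⟪x - t, y - t⟫ / (‖x - t‖ ^ (d₂+1) * ‖y - t‖ ^ (d₃+1) * ‖z - t‖ ^ d₁)) ∧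
    ∫ t : Euc d,
        ⟪x - t, y - t⟫ / (‖x - t‖ ^ (d₂+1) * ‖y - t‖ ^ (d₃+1) * ‖z - t‖ ^ d₁)
      = CMOZ d₁ d₂ d₃ d *
        (⟪x - z, y - z⟫ /
          (‖x - z‖ ^ ((d:ℝ) - d₃ + 1) * ‖y - z‖ ^ ((d:ℝ) - d₂ + 1) *
            ‖x - y‖ ^ ((d:ℝ) - d₁))) := by
  obtain ⟨hI, hE⟩ := integrable_and_integral_angular_kernel_zero (by lia)
    (sub_ne_zero.2 hxz) (sub_ne_zero.2 hyz) (fun h => hxy (sub_left_injective h))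
    h₁.2 h₂.2 h₃.2 hsum
  rw [sub_sub_sub_cancel_right] at hE
  rw [← integral_sub_right_eq_self _ z] at hE
  have h := hI.comp_sub_right z
  simp only [sub_sub_sub_cancel_right, norm_sub_rev _ z] at h hE
  rw [norm_sub_rev z x, norm_sub_rev z y] at hE
  exact ⟨h, hE⟩
end
end
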